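/- Let n ≥ 1, −1 < γ < 0, 1 < p < ∞, and let u be a viscosity solution of ∂_t u − |Du|^γ Δ_p^N u = f in Q₁ with osc_{Q₁} u ≤ 1. Then for every τ > 0 there exists ε₀ = ε₀(p,n,γ,τ) ∈ (0,1) such that if ‖f‖_{L^∞(Q₁)} ≤ ε₀, then there exists a viscosity solution ũ of ∂_t ũ = |Dũ|^γ Δ_p^N ũ in Q_{11/16} with ‖u − ũ‖_{L^∞(Q_{5/8})} ≤ τ. -/

import Mathlib

open Set Real RealInnerProductSpace

noncomputable section

/-- `ℝⁿ` with the Euclidean structure. -/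
abbrev En (n : ℕ) : Type := EuclideanSpace ℝ (Fin n)

/-- The parabolic cylinder `Q_r := B_r(0) × (-r², 0) ⊂ ℝⁿ × ℝ`. -/
def pCyl (n : ℕ) (r : ℝ) : Set (En n × ℝ) :=
  {z | ‖z.1‖ < r ∧ z.2 ∈ Set.Ioo (-r ^ 2) (0 : ℝ)}

/-- The intrinsic cylinder `Q_r^a := B_r(0) × (-r² a^{-γ}, 0)`. -/
def iCyl (n : ℕ) (γ r a : ℝ) : Set (En n × ℝ) :=
  {z | ‖z.1‖ < r ∧ z.2 ∈ Set.Ioo (-(r ^ 2 * a ^ (-γ))) (0 : ℝ)}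

/-- Spatial gradient of a function of space and time. -/
def sGrad {n : ℕ} (φ : En n × ℝ → ℝ) (x : En n) (t : ℝ) : En n :=
  gradient (fun y => φ (y, t)) x

/-- Spatial Hessian of a function of space and time. -/
def sHess {n : ℕ} (φ : En n × ℝ → ℝ) (x : En n) (t : ℝ) : En n →L[ℝ] En n :=
  fderiv ℝ (fun y => sGrad φ y t) x

/-- The value `|q|^γ (tr H + (p-2) ⟨H q, q⟩ / |q|²)`, i.e. `|q|^γ` times the normalized
`p`-Laplacian computed from a gradient `q ≠ 0` and a Hessian `H`. -/
def opVal {n : ℕ} (γ p : ℝ) (q : En n) (H : En n →L[ℝ] En n) : ℝ :=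
  ‖q‖ ^ γ * (LinearMap.trace ℝ (En n) H.toLinearMap + (p - 2) * ⟪H q, q⟫ / ‖q‖ ^ 2)

/-- Viscosity supersolution of `∂ₜ u - |Du|^γ Δ_p^N u = f` on `Ω`. -/
def IsSupersol {n : ℕ} (γ p : ℝ) (f u : En n × ℝ → ℝ) (Ω : Set (En n × ℝ)) : Prop :=
  (∀ z ∈ Ω, ∀ φ : En n × ℝ → ℝ, ContDiff ℝ 2 φ →
      sGrad φ z.1 z.2 ≠ 0 → φ z = u z → (∀ w ∈ Ω, φ w ≤ u w) →
      f z ≤ deriv (fun s => φ (z.1, s)) z.2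
            - opVal γ p (sGrad φ z.1 z.2) (sHess φ z.1 z.2)) ∧
  (∀ z ∈ Ω, ∀ δ : ℝ, 0 < δ → ∀ φ : ℝ → ℝ,
      ContDiffOn ℝ 1 φ (Set.Ioo (z.2 - δ) (z.2 + δ)) → φ z.2 = 0 →
      (∀ t ∈ Set.Ioo (z.2 - δ) (z.2 + δ), u (z.1, z.2) ≤ u (z.1, t) - φ t) →
      (∃ ε > (0:ℝ), ∃ c : ℝ, ∀ x : En n, ‖x - z.1‖ < ε →
          sInf ((fun t => u (x, t) - φ t) '' Set.Ioo (z.2 - δ) (z.2 + δ)) = c) →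
      f z ≤ deriv φ z.2)

/-- Viscosity subsolution of `∂ₜ u - |Du|^γ Δ_p^N u = f` on `Ω`. -/
def IsSubsol {n : ℕ} (γ p : ℝ) (f u : En n × ℝ → ℝ) (Ω : Set (En n × ℝ)) : Prop :=
  (∀ z ∈ Ω, ∀ φ : En n × ℝ → ℝ, ContDiff ℝ 2 φ →
      sGrad φ z.1 z.2 ≠ 0 → φ z = u z → (∀ w ∈ Ω, u w ≤ φ w) →
      deriv (fun s => φ (z.1, s)) z.2
            - opVal γ p (sGrad φ z.1 z.2) (sHess φ z.1 z.2) ≤ f z) ∧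
  (∀ z ∈ Ω, ∀ δ : ℝ, 0 < δ → ∀ φ : ℝ → ℝ,
      ContDiffOn ℝ 1 φ (Set.Ioo (z.2 - δ) (z.2 + δ)) → φ z.2 = 0 →
      (∀ t ∈ Set.Ioo (z.2 - δ) (z.2 + δ), u (z.1, t) - φ t ≤ u (z.1, z.2)) →
      (∃ ε > (0:ℝ), ∃ c : ℝ, ∀ x : En n, ‖x - z.1‖ < ε →
          sSup ((fun t => u (x, t) - φ t) '' Set.Ioo (z.2 - δ) (z.2 + δ)) = c) →
      deriv φ z.2 ≤ f z)

/-- Viscosity solution of `∂ₜ u - |Du|^γ Δ_p^N u = f` on `Ω`: a continuous function which is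
both a viscosity supersolution and a viscosity subsolution. -/
def IsViscSol {n : ℕ} (γ p : ℝ) (f u : En n × ℝ → ℝ) (Ω : Set (En n × ℝ)) : Prop :=
  ContinuousOn u Ω ∧ IsSupersol γ p f u Ω ∧ IsSubsol γ p f u Ω

/-- Viscosity solution of the deviation equation
`∂ₜ w - |Dw+K|^γ [Δw + (p-2)⟨D²w (Dw+K), Dw+K⟩/|Dw+K|²] = f` on `Ω`; equivalently,
`u(x,t) := w(x,t) + K·x` is a viscosity solution of `∂ₜ u - |Du|^γ Δ_p^N u = f`. -/
def IsDevSol {n : ℕ} (γ p : ℝ) (K : En n) (f w : En n × ℝ → ℝ) (Ω : Set (En n × ℝ)) : Prop :=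
  IsViscSol γ p f (fun z => w z + ⟪K, z.1⟫) Ω

section helpers
open Filter Topology

/-- time derivative of a test function at a space-time point -/
def tD {n : ℕ} (φ : En n × ℝ → ℝ) (z : En n × ℝ) : ℝ := deriv (fun s => φ (z.1, s)) z.2

/-- the operator evaluated on a test function -/
def opF {n : ℕ} (γ p : ℝ) (φ : En n × ℝ → ℝ) (z : En n × ℝ) : ℝ :=
  opVal γ p (sGrad φ z.1 z.2) (sHess φ z.1 z.2)

section calculus
variable {n : ℕ}

lemma hasFDerivAt_slice {φ : En n × ℝ → ℝ} (hφ : Differentiable ℝ φ) (x : En n) (t : ℝ) :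
    HasFDerivAt (fun y => φ (y, t)) ((fderiv ℝ φ (x, t)).comp (ContinuousLinearMap.inl ℝ (En n) ℝ)) x := by
  have h1 : HasFDerivAt (fun y : En n => (y, t)) (ContinuousLinearMap.inl ℝ (En n) ℝ) x :=
    hasFDerivAt_prodMk_left x t
  exact ((hφ (x, t)).hasFDerivAt).comp x h1

lemma sGrad_eq {φ : En n × ℝ → ℝ} (hφ : Differentiable ℝ φ) (x : En n) (t : ℝ) :
    sGrad φ x t = (InnerProductSpace.toDual ℝ (En n)).symm
      ((fderiv ℝ φ (x, t)).comp (ContinuousLinearMap.inl ℝ (En n) ℝ)) := by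
  unfold sGrad gradient
  rw [(hasFDerivAt_slice hφ x t).fderiv]

lemma sGrad_contDiff {φ : En n × ℝ → ℝ} (hφ : ContDiff ℝ 2 φ) :
    ContDiff ℝ 1 (fun z : En n × ℝ => sGrad φ z.1 z.2) := by
  have h0 : (fun z : En n × ℝ => sGrad φ z.1 z.2) = fun z =>
      (InnerProductSpace.toDual ℝ (En n)).symm
      ((fderiv ℝ φ z).comp (ContinuousLinearMap.inl ℝ (En n) ℝ)) := by
    funext z
    exact sGrad_eq (hφ.differentiable (by norm_num)) z.1 z.2
  rw [h0]
  have h1 : ContDiff ℝ 1 (fderiv ℝ φ) := hφ.fderiv_right (by norm_num)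
  have h2 : ContDiff ℝ 1 (fun z => (fderiv ℝ φ z).comp (ContinuousLinearMap.inl ℝ (En n) ℝ)) :=
    h1.clm_comp contDiff_const
  exact ((InnerProductSpace.toDual ℝ (En n)).symm.toContinuousLinearEquiv.contDiff).comp h2

lemma sHess_eq {φ : En n × ℝ → ℝ} (hφ : ContDiff ℝ 2 φ) (z : En n × ℝ) :
    sHess φ z.1 z.2 = (fderiv ℝ (fun z : En n × ℝ => sGrad φ z.1 z.2) z).comp
      (ContinuousLinearMap.inl ℝ (En n) ℝ) := by
  have h1 : HasFDerivAt (fun y : En n => (y, z.2)) (ContinuousLinearMap.inl ℝ (En n) ℝ) z.1 :=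
    hasFDerivAt_prodMk_left z.1 z.2
  have h2 := (((sGrad_contDiff hφ).differentiable (by norm_num)) (z.1, z.2)).hasFDerivAt
  exact (h2.comp z.1 h1).fderiv

lemma sGrad_cont {φ : En n × ℝ → ℝ} (hφ : ContDiff ℝ 2 φ) :
    Continuous (fun z : En n × ℝ => sGrad φ z.1 z.2) := (sGrad_contDiff hφ).continuous

lemma sHess_cont {φ : En n × ℝ → ℝ} (hφ : ContDiff ℝ 2 φ) :
    Continuous (fun z : En n × ℝ => sHess φ z.1 z.2) := by
  have : (fun z : En n × ℝ => sHess φ z.1 z.2) = fun z =>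
      (fderiv ℝ (fun z : En n × ℝ => sGrad φ z.1 z.2) z).comp
      (ContinuousLinearMap.inl ℝ (En n) ℝ) := funext (sHess_eq hφ)
  rw [this]
  have h1 := (sGrad_contDiff hφ).continuous_fderiv (by norm_num)
  exact h1.clm_comp continuous_const

lemma sGrad_hasFDeriv {φ : En n × ℝ → ℝ} (hφ : ContDiff ℝ 2 φ) (x : En n) (t : ℝ) :
    DifferentiableAt ℝ (fun y => sGrad φ y t) x := by
  have h2 := (((sGrad_contDiff hφ).differentiable (by norm_num)) (x, t)).hasFDerivAt
  have h1 : HasFDerivAt (fun y : En n => (y, t)) (ContinuousLinearMap.inl ℝ (En n) ℝ) x :=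
    hasFDerivAt_prodMk_left x t
  exact (h2.comp x h1).differentiableAt

lemma tD_eq {φ : En n × ℝ → ℝ} (hφ : Differentiable ℝ φ) (z : En n × ℝ) :
    tD φ z = fderiv ℝ φ z (0, 1) := by
  have h1 : HasFDerivAt (fun s : ℝ => (z.1, s)) (ContinuousLinearMap.inr ℝ (En n) ℝ) z.2 :=
    hasFDerivAt_prodMk_right z.1 z.2
  have h2 := ((hφ (z.1, z.2)).hasFDerivAt).comp z.2 h1
  have h3 := h2.hasDerivAt.deriv
  unfold tD
  exact h3.trans (by simp)

lemma tD_cont {φ : En n × ℝ → ℝ} (hφ : ContDiff ℝ 2 φ) : Continuous (tD φ) := by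
  have : tD φ = fun z => fderiv ℝ φ z (0, 1) :=
    funext (tD_eq (hφ.differentiable (by norm_num)))
  rw [this]
  exact (hφ.continuous_fderiv (by norm_num)).clm_apply continuous_const

lemma opVal_continuousAt (γ p : ℝ) {X : Type*} [TopologicalSpace X] {q : X → En n}
    {H : X → (En n →L[ℝ] En n)} {x : X} (hq : ContinuousAt q x) (hH : ContinuousAt H x)
    (h0 : q x ≠ 0) : ContinuousAt (fun y => opVal γ p (q y) (H y)) x := by
  unfold opVal
  have hn : ‖q x‖ ≠ 0 := norm_ne_zero_iff.2 h0
  have htr : Continuous (fun A : En n →L[ℝ] En n => LinearMap.trace ℝ (En n) A.toLinearMap) :=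
    LinearMap.continuous_of_finiteDimensional
      ((LinearMap.trace ℝ (En n)).comp (ContinuousLinearMap.coeLM ℝ))
  refine ContinuousAt.mul (hq.norm.rpow_const (Or.inl hn)) ?_
  refine ContinuousAt.add (htr.continuousAt.comp hH) ?_
  refine ContinuousAt.div ?_ (hq.norm.pow 2) (pow_ne_zero _ hn)
  exact continuousAt_const.mul (ContinuousAt.inner (hH.clm_apply hq) hq)

lemma opF_continuousAt (γ p : ℝ) {φ : En n × ℝ → ℝ} (hφ : ContDiff ℝ 2 φ) {z : En n × ℝ}
    (h0 : sGrad φ z.1 z.2 ≠ 0) : ContinuousAt (opF γ p φ) z :=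
  opVal_continuousAt γ p (sGrad_cont hφ).continuousAt (sHess_cont hφ).continuousAt h0

lemma sGrad_add {φ ψ : En n × ℝ → ℝ} (hφ : ContDiff ℝ 2 φ) (hψ : ContDiff ℝ 2 ψ) (x : En n) (t : ℝ) :
    sGrad (fun z => φ z + ψ z) x t = sGrad φ x t + sGrad ψ x t := by
  have h1 := hφ.differentiable (by norm_num)
  have h2 := hψ.differentiable (by norm_num)
  rw [sGrad_eq (h1.fun_add h2), sGrad_eq h1, sGrad_eq h2, ← map_add, fderiv_fun_add (h1 _) (h2 _)]
  congr 1

lemma sHess_add {φ ψ : En n × ℝ → ℝ} (hφ : ContDiff ℝ 2 φ) (hψ : ContDiff ℝ 2 ψ) (x : En n) (t : ℝ) :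
    sHess (fun z => φ z + ψ z) x t = sHess φ x t + sHess ψ x t := by
  unfold sHess
  have : (fun y => sGrad (fun z => φ z + ψ z) y t) = fun y => sGrad φ y t + sGrad ψ y t :=
    funext fun y => sGrad_add hφ hψ y t
  rw [this, fderiv_fun_add (sGrad_hasFDeriv hφ x t) (sGrad_hasFDeriv hψ x t)]

lemma tD_add {φ ψ : En n × ℝ → ℝ} (hφ : ContDiff ℝ 2 φ) (hψ : ContDiff ℝ 2 ψ) (z : En n × ℝ) :
    tD (fun z => φ z + ψ z) z = tD φ z + tD ψ z := by
  have h1 := hφ.differentiable (by norm_num)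
  have h2 := hψ.differentiable (by norm_num)
  rw [tD_eq (h1.fun_add h2), tD_eq h1, tD_eq h2, fderiv_fun_add (h1 _) (h2 _)]
  rfl

/-- radial test functions `g(t) + h(|x-y|²)` -/
def rad (g h : ℝ → ℝ) (y : En n) : En n × ℝ → ℝ := fun z => g z.2 + h (‖z.1 - y‖ ^ 2)

lemma rad_contDiff {g h : ℝ → ℝ} (hg : ContDiff ℝ 2 g) (hh : ContDiff ℝ 2 h) (y : En n) :
    ContDiff ℝ 2 (rad g h y) := by
  unfold rad
  have h1 : ContDiff ℝ 2 (fun z : En n × ℝ => ‖z.1 - y‖ ^ 2) :=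
    (contDiff_fst.sub contDiff_const).norm_sq ℝ
  exact (hg.comp contDiff_snd).add (hh.comp h1)

lemma tD_rad (g h : ℝ → ℝ) (y : En n) (z : En n × ℝ) : tD (rad g h y) z = deriv g z.2 := by
  unfold tD rad
  simp

lemma sGrad_rad (g : ℝ → ℝ) {h : ℝ → ℝ} (hh : Differentiable ℝ h) (y x : En n) (t : ℝ) :
    sGrad (rad g h y) x t = (2 * deriv h (‖x - y‖ ^ 2)) • (x - y) := by
  have h1 : HasFDerivAt (fun x : En n => ‖x - y‖ ^ 2)
      (2 • (innerSL ℝ (x - y)).comp (ContinuousLinearMap.id ℝ (En n))) x :=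
    ((hasFDerivAt_id x).sub_const y).norm_sq
  have h2 := ((hh (‖x - y‖ ^ 2)).hasDerivAt.comp_hasFDerivAt x h1).const_add (g t)
  have h3 : HasGradientAt (fun x => rad g h y (x, t)) ((2 * deriv h (‖x - y‖ ^ 2)) • (x - y)) x := by
    rw [hasGradientAt_iff_hasFDerivAt]
    refine HasFDerivAt.congr_fderiv h2 ?_
    ext v
    simp
    ring
  exact h3.gradient

lemma sHess_rad (g : ℝ → ℝ) {h : ℝ → ℝ} (hh : ContDiff ℝ 2 h) (y x : En n) (t : ℝ) :
    sHess (rad g h y) x t = (2 * deriv h (‖x - y‖ ^ 2)) • ContinuousLinearMap.id ℝ (En n) +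
      (4 * deriv (deriv h) (‖x - y‖ ^ 2)) • (innerSL ℝ (x - y)).smulRight (x - y) := by
  unfold sHess
  have h0 : (fun x => sGrad (rad g h y) x t) = fun x => (2 * deriv h (‖x - y‖ ^ 2)) • (x - y) :=
    funext fun x => sGrad_rad g (hh.differentiable (by norm_num)) y x t
  rw [h0]
  have h1 : HasFDerivAt (fun x : En n => ‖x - y‖ ^ 2)
      (2 • (innerSL ℝ (x - y)).comp (ContinuousLinearMap.id ℝ (En n))) x :=
    ((hasFDerivAt_id x).sub_const y).norm_sq
  have hd : Differentiable ℝ (deriv h) :=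
    ((contDiff_succ_iff_deriv (n := 1)).1 hh).2.2.differentiable (by norm_num)
  have h2 := ((hd (‖x - y‖ ^ 2)).hasDerivAt.comp_hasFDerivAt x h1).const_mul 2
  have h3 : HasFDerivAt (fun x : En n => x - y) (ContinuousLinearMap.id ℝ (En n)) x :=
    (hasFDerivAt_id x).sub_const y
  have h4 := h2.smul h3
  refine h4.fderiv.trans ?_
  ext v
  simp
  ring

/-- the operator on radial test functions -/
lemma opF_rad (γ p : ℝ) (g : ℝ → ℝ) {h : ℝ → ℝ} (hh : ContDiff ℝ 2 h) (y : En n) (z : En n × ℝ)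
    (h0 : z.1 ≠ y) (hd : deriv h (‖z.1 - y‖ ^ 2) ≠ 0) :
    opF γ p (rad g h y) z = ‖(2 * deriv h (‖z.1 - y‖ ^ 2)) • (z.1 - y)‖ ^ γ *
      (2 * deriv h (‖z.1 - y‖ ^ 2) * (n + p - 2)
        + 4 * (p - 1) * deriv (deriv h) (‖z.1 - y‖ ^ 2) * ‖z.1 - y‖ ^ 2) := by
  unfold opF opVal
  rw [sGrad_rad g (hh.differentiable (by norm_num)), sHess_rad g hh]
  set a := deriv h (‖z.1 - y‖ ^ 2)
  set b := deriv (deriv h) (‖z.1 - y‖ ^ 2)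
  set d := z.1 - y with hdd
  have hdn : ‖d‖ ≠ 0 := norm_ne_zero_iff.2 (sub_ne_zero.2 h0)
  have htr : LinearMap.trace ℝ (En n) (((2 * a) • ContinuousLinearMap.id ℝ (En n) +
      (4 * b) • (innerSL ℝ d).smulRight d).toLinearMap) = 2 * a * n + 4 * b * ‖d‖ ^ 2 := by
    have : ((2 * a) • ContinuousLinearMap.id ℝ (En n) +
      (4 * b) • (innerSL ℝ d).smulRight d).toLinearMap = (2 * a) • LinearMap.id +
        (4 * b) • ((innerSL ℝ d).toLinearMap).smulRight d := by
      ext v; simp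
    rw [this]
    simp [LinearMap.trace_smulRight]
  rw [htr]
  congr 1
  have hin : ⟪((2 * a) • ContinuousLinearMap.id ℝ (En n) +
      (4 * b) • (innerSL ℝ d).smulRight d) ((2 * a) • d), (2 * a) • d⟫
      = (2 * a) ^ 2 * ‖d‖ ^ 2 * (2 * a + 4 * b * ‖d‖ ^ 2) := by
    simp [inner_add_left, inner_smul_left, inner_smul_right]
    ring
  rw [hin, norm_smul, mul_pow ‖2 * a‖ ‖d‖ 2, Real.norm_eq_abs, sq_abs]
  field_simp
  ring

end calculus


section elliptic
variable {n : ℕ}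

lemma second_deriv_nonneg {f : ℝ → ℝ} {x : ℝ} (hf : ContDiff ℝ 2 f) (h : IsLocalMin f x) :
    0 ≤ deriv (deriv f) x := by
  by_contra hneg
  push Not at hneg
  set k := -(deriv (deriv f) x) / 4 with hk
  have hkpos : 0 < k := by rw [hk]; linarith
  have hfd : Differentiable ℝ f := hf.differentiable (by norm_num)
  have hd : Differentiable ℝ (deriv f) :=
    ((contDiff_succ_iff_deriv (n := 1)).1 hf).2.2.differentiable (by norm_num)
  let F : ℝ → ℝ := fun s => -(f s) - k * (s - x) ^ 2
  have hF1 : ∀ s, HasDerivAt F (-(deriv f s) - k * (2 * (s - x))) s := by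
    intro s
    have h1 := ((hfd s).hasDerivAt.neg)
    have h2 := (((hasDerivAt_id s).sub_const x).pow 2).const_mul k
    have h3 := h1.sub h2
    refine h3.congr_deriv ?_
    simp
  have hF2 : deriv F = fun s => -(deriv f s) - k * (2 * (s - x)) := funext fun s => (hF1 s).deriv
  have hF3 : HasDerivAt (deriv F) (-(deriv (deriv f) x) - k * 2) x := by
    rw [hF2]
    have h1 := (hd x).hasDerivAt.neg
    have h2 := ((((hasDerivAt_id x).sub_const x).const_mul 2)).const_mul k
    refine (h1.sub h2).congr_deriv ?_
    simp
  have hmin : IsLocalMin F x := by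
    apply isLocalMin_of_deriv_deriv_pos
    · rw [hF3.deriv, hk]; linarith
    · rw [(hF1 x).deriv, h.deriv_eq_zero]; simp
    · exact (hF1 x).continuousAt
  have h3 : ∀ᶠ s in 𝓝 x, s = x := by
    filter_upwards [hmin, h] with s h1 h2
    simp only [F] at h1
    have h4 : k * (s - x) ^ 2 ≤ 0 := by
      simp at h1
      linarith
    have h5 : (s - x) ^ 2 ≤ 0 := by
      by_contra h6
      push Not at h6
      have := mul_pos hkpos h6
      linarith
    have h6 : s - x = 0 := by
      have := le_antisymm h5 (sq_nonneg _)
      exact pow_eq_zero_iff (two_ne_zero) |>.1 this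
    linarith
  obtain ⟨e, he, hb⟩ := Metric.eventually_nhds_iff.1 h3
  have := hb (y := x + e / 2) (by simp [abs_of_pos he]; linarith)
  linarith

lemma locmin_tD {χ : En n × ℝ → ℝ} (hχ : ContDiff ℝ 2 χ) {z : En n × ℝ} (h : IsLocalMin χ z) :
    tD χ z = 0 := by
  rw [tD_eq (hχ.differentiable (by norm_num)), h.fderiv_eq_zero]; rfl

lemma locmin_sGrad {χ : En n × ℝ → ℝ} (hχ : ContDiff ℝ 2 χ) {z : En n × ℝ} (h : IsLocalMin χ z) :
    sGrad χ z.1 z.2 = 0 := by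
  rw [sGrad_eq (hχ.differentiable (by norm_num)), Prod.mk.eta, h.fderiv_eq_zero]; simp

lemma locmin_sHess {χ : En n × ℝ → ℝ} (hχ : ContDiff ℝ 2 χ) {z : En n × ℝ} (h : IsLocalMin χ z)
    (v : En n) : 0 ≤ ⟪sHess χ z.1 z.2 v, v⟫ := by
  let f : ℝ → ℝ := fun s => χ (z.1 + s • v, z.2)
  have hl : ContDiff ℝ 2 (fun s : ℝ => ((z.1 + s • v, z.2) : En n × ℝ)) :=
    (contDiff_const.add (contDiff_id.smul contDiff_const)).prodMk contDiff_const
  have hf : ContDiff ℝ 2 f := hχ.comp hl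
  have hmin : IsLocalMin f 0 := by
    have hc : ContinuousAt (fun s : ℝ => ((z.1 + s • v, z.2) : En n × ℝ)) 0 := hl.continuous.continuousAt
    have : Tendsto (fun s : ℝ => ((z.1 + s • v, z.2) : En n × ℝ)) (𝓝 0) (𝓝 z) := by
      have h2 := hc.tendsto
      simpa using h2
    have h3 := this.eventually h
    unfold IsLocalMin IsMinFilter
    simpa [f] using h3
  have h2 := second_deriv_nonneg hf hmin
  have hlin : ∀ s : ℝ, HasDerivAt (fun s : ℝ => z.1 + s • v) v s := by
    intro s
    have := ((hasDerivAt_id s).smul_const v).const_add z.1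
    simpa using this
  have hd1 : ∀ s, HasDerivAt f ⟪sGrad χ (z.1 + s • v) z.2, v⟫ s := by
    intro s
    have h3 := (hasFDerivAt_slice (hχ.differentiable (by norm_num)) (z.1 + s • v) z.2)
    have h4 := h3.comp_hasDerivAt s (hlin s)
    refine h4.congr_deriv ?_
    rw [sGrad_eq (hχ.differentiable (by norm_num)), InnerProductSpace.toDual_symm_apply]
  have hd1' : deriv f = fun s => ⟪sGrad χ (z.1 + s • v) z.2, v⟫ := funext fun s => (hd1 s).deriv
  have hd2 : HasDerivAt (deriv f) ⟪sHess χ z.1 z.2 v, v⟫ 0 := by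
    rw [hd1']
    have h3 : HasFDerivAt (fun y => sGrad χ y z.2) (sHess χ z.1 z.2) (z.1 + (0:ℝ) • v) := by
      have := (sGrad_hasFDeriv hχ z.1 z.2).hasFDerivAt
      simpa [sHess] using this
    have h4 := h3.comp_hasDerivAt (0:ℝ) (hlin 0)
    have h5 := h4.inner ℝ (hasDerivAt_const (0:ℝ) v)
    refine h5.congr_deriv ?_
    simp
  rwa [hd2.deriv] at h2

lemma opVal_nonneg {γ p : ℝ} (hp : 1 < p) {q : En n} (hq : q ≠ 0) {H : En n →L[ℝ] En n}
    (hH : ∀ v, 0 ≤ ⟪H v, v⟫) : 0 ≤ opVal γ p q H := by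
  unfold opVal
  refine mul_nonneg (Real.rpow_nonneg (norm_nonneg _) _) ?_
  have hqn : 0 < ‖q‖ := norm_pos_iff.2 hq
  have key : ⟪H q, q⟫ / ‖q‖ ^ 2 ≤ LinearMap.trace ℝ (En n) H.toLinearMap := by
    set e : En n := (‖q‖⁻¹) • q with he
    have hen : ‖e‖ = 1 := by rw [he, norm_smul]; simp [hqn.ne']
    have hs : Orthonormal ℝ ((↑) : ({e} : Set (En n)) → En n) := by
      constructor
      · rintro ⟨i, hi⟩
        simp at hi; subst hi; exact hen
      · rintro ⟨i, hi⟩ ⟨j, hj⟩ hij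
        simp at hi hj; subst hi; subst hj; exact absurd rfl hij
    obtain ⟨u, b, hu, hb⟩ := hs.exists_orthonormalBasis_extension
    rw [LinearMap.trace_eq_sum_inner _ b]
    have hmem : e ∈ u := by
      have := hu (Set.mem_singleton e)
      simpa using this
    have h1 : ⟪b ⟨e, hmem⟩, H.toLinearMap (b ⟨e, hmem⟩)⟫ ≤ ∑ i, ⟪b i, H.toLinearMap (b i)⟫ := by
      apply Finset.single_le_sum (f := fun i => ⟪b i, H.toLinearMap (b i)⟫)
      · intro i _
        have := hH (b i)
        rw [real_inner_comm] at this
        exact this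
      · exact Finset.mem_univ _
    refine le_trans (le_of_eq ?_) h1
    rw [hb, real_inner_comm]
    simp only [he]
    simp only [ContinuousLinearMap.coe_coe, map_smul, inner_smul_left, inner_smul_right]
    simp
    field_simp
  have h2 : 0 ≤ ⟪H q, q⟫ / ‖q‖ ^ 2 := div_nonneg (hH q) (by positivity)
  rw [mul_div_assoc]
  nlinarith

lemma opVal_add (γ p : ℝ) (q : En n) (H K : En n →L[ℝ] En n) :
    opVal γ p q (H + K) = opVal γ p q H + opVal γ p q K := by
  unfold opVal
  have : (H + K).toLinearMap = H.toLinearMap + K.toLinearMap := rfl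
  rw [this, map_add, _root_.add_apply, inner_add_left]
  ring

lemma opVal_neg_left (γ p : ℝ) (q : En n) (H : En n →L[ℝ] En n) :
    opVal γ p (-q) H = opVal γ p q H := by
  unfold opVal
  simp

lemma opVal_neg_neg (γ p : ℝ) (q : En n) (H : En n →L[ℝ] En n) :
    opVal γ p (-q) (-H) = - opVal γ p q H := by
  rw [opVal_neg_left]
  have := opVal_add γ p q H (-H)
  have h0 : opVal γ p q (0 : En n →L[ℝ] En n) = 0 := by simp [opVal]
  rw [add_neg_cancel, h0] at this
  linarith

end elliptic

section subat
variable {n : ℕ}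

/-- The notion of subsolution at a point used in the proof. -/
def SubAt (γ p : ℝ) (m : ℕ) (c : ℝ) (w : En n × ℝ → ℝ) (z : En n × ℝ) : Prop :=
  (∀ φ : En n × ℝ → ℝ, ContDiff ℝ 2 φ → sGrad φ z.1 z.2 ≠ 0 → φ z = w z →
    (∀ᶠ y in 𝓝 z, w y ≤ φ y) → tD φ z - opF γ p φ z ≤ c) ∧
  (∀ g : ℝ → ℝ, ContDiff ℝ 2 g → ∀ A : ℝ, 0 < A →
    (∀ᶠ y in 𝓝 z, w y ≤ w z + (g y.2 - g z.2) + A * (‖y.1 - z.1‖ ^ 2) ^ m) → deriv g z.2 ≤ c)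

/-- Test functions which cannot touch a subsolution from above. -/
def Bad (γ p : ℝ) (m : ℕ) (c : ℝ) (φ : En n × ℝ → ℝ) (z : En n × ℝ) : Prop :=
  (sGrad φ z.1 z.2 ≠ 0 ∧ c < tD φ z - opF γ p φ z) ∨
  (∃ g : ℝ → ℝ, ∃ A : ℝ, ContDiff ℝ 2 g ∧ 0 < A ∧ c < deriv g z.2 ∧
    φ = rad g (fun s => A * s ^ m) z.1)

variable {γ p : ℝ} {m : ℕ}

lemma SubAt.mono_c {c c' : ℝ} {w : En n × ℝ → ℝ} {z : En n × ℝ} (h : SubAt γ p m c w z)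
    (hc : c ≤ c') : SubAt γ p m c' w z :=
  ⟨fun φ a b d e => (h.1 φ a b d e).trans hc, fun g a A b d => (h.2 g a A b d).trans hc⟩

/-- a function above a subsolution, touching it, is a subsolution -/
lemma SubAt.of_le {c : ℝ} {w W : En n × ℝ → ℝ} {z : En n × ℝ} (h : SubAt γ p m c w z)
    (hle : ∀ᶠ y in 𝓝 z, w y ≤ W y) (heq : w z = W z) : SubAt γ p m c W z := by
  refine ⟨fun φ a b d e => h.1 φ a b (d.trans heq.symm) ?_, fun g a A b d => h.2 g a A b ?_⟩
  · filter_upwards [hle, e] with y h1 h2 using h1.trans h2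
  · filter_upwards [hle, d] with y h1 h2
    rw [heq]; exact h1.trans h2

lemma timeC2 {k : ℝ → ℝ} (hk : ContDiff ℝ 2 k) : ContDiff ℝ 2 (fun z : En n × ℝ => k z.2) :=
  hk.comp contDiff_snd

lemma sGrad_add_time (φ : En n × ℝ → ℝ) (k : ℝ → ℝ) (x : En n) (t : ℝ) :
    sGrad (fun z => φ z + k z.2) x t = sGrad φ x t := by
  unfold sGrad gradient
  simp

lemma opF_add_time (φ : En n × ℝ → ℝ) (k : ℝ → ℝ) (z : En n × ℝ) :
    opF γ p (fun z => φ z + k z.2) z = opF γ p φ z := by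
  unfold opF sHess
  simp only [sGrad_add_time]

lemma tD_add_time {φ : En n × ℝ → ℝ} (hφ : ContDiff ℝ 2 φ) {k : ℝ → ℝ} (hk : ContDiff ℝ 2 k)
    (z : En n × ℝ) : tD (fun z => φ z + k z.2) z = tD φ z + deriv k z.2 := by
  rw [tD_add hφ (timeC2 hk)]
  rfl

lemma SubAt.add_time {c : ℝ} {w : En n × ℝ → ℝ} {z : En n × ℝ} (h : SubAt γ p m c w z)
    {k : ℝ → ℝ} (hk : ContDiff ℝ 2 k) : SubAt γ p m (c + deriv k z.2) (fun y => w y + k y.2) z := by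
  constructor
  · intro φ a b d e
    have hnk : ContDiff ℝ 2 (fun t => - k t) := hk.neg
    have h1 := h.1 (fun y => φ y + (fun t => - k t) y.2) (a.add (timeC2 hnk))
      (by rw [sGrad_add_time φ (fun t => - k t)]; exact b) (by simp only; linarith)
      (by filter_upwards [e] with y hy; linarith)
    rw [opF_add_time φ (fun t => - k t), tD_add_time a hnk] at h1
    simp only [deriv.fun_neg] at h1
    linarith
  · intro g a A b d
    have h1 := h.2 (fun t => g t - k t) (a.sub hk) A b
      (by filter_upwards [d] with y hy; linarith)
    have h2 : deriv (fun t => g t - k t) z.2 = deriv g z.2 - deriv k z.2 :=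
      deriv_fun_sub (a.differentiable (by norm_num) _) (hk.differentiable (by norm_num) _)
    rw [h2] at h1
    linarith

lemma sGrad_translate (φ : En n × ℝ → ℝ) (h : En n × ℝ) (x : En n) (t : ℝ) :
    sGrad (fun z => φ (z + h)) x t = sGrad φ (x + h.1) (t + h.2) := by
  unfold sGrad gradient
  congr 1
  exact fderiv_comp_add_right (f := fun y => φ (y, t + h.2)) h.1

lemma sHess_translate (φ : En n × ℝ → ℝ) (h : En n × ℝ) (x : En n) (t : ℝ) :
    sHess (fun z => φ (z + h)) x t = sHess φ (x + h.1) (t + h.2) := by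
  unfold sHess
  simp only [sGrad_translate]
  exact fderiv_comp_add_right (f := fun y => sGrad φ y (t + h.2)) h.1

lemma tD_translate (φ : En n × ℝ → ℝ) (h : En n × ℝ) (z : En n × ℝ) :
    tD (fun z => φ (z + h)) z = tD φ (z + h) := by
  unfold tD
  exact deriv_comp_add_const (f := fun s => φ (z.1 + h.1, s)) h.2 z.2

lemma SubAt.translate {c : ℝ} {w : En n × ℝ → ℝ} {z h : En n × ℝ} (hw : SubAt γ p m c w (z + h)) :
    SubAt γ p m c (fun y => w (y + h)) z := by
  have ht : Tendsto (fun y : En n × ℝ => y + (-h)) (𝓝 (z + h)) (𝓝 z) := by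
    have : Continuous (fun y : En n × ℝ => y + (-h)) := by fun_prop
    have := this.tendsto (z + h)
    simpa using this
  constructor
  · intro φ a b d e
    have hz : z + h + -h = z := by abel
    have h1 := hw.1 (fun y => φ (y + (-h))) (a.comp (by fun_prop))
      (by
        rw [sGrad_translate]
        have e1 : (z + h).1 + (-h).1 = z.1 := by simp
        have e2 : (z + h).2 + (-h).2 = z.2 := by simp
        rw [e1, e2]; exact b)
      (by simp only [hz]; exact d)
      (by
        filter_upwards [ht.eventually e] with y hy
        simpa using hy)
    unfold opF at h1
    rw [sGrad_translate, sHess_translate, tD_translate, hz] at h1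
    simp only [Prod.fst_add, Prod.snd_add, Prod.fst_neg, Prod.snd_neg, add_neg_cancel_right] at h1
    exact h1
  · intro g a A b d
    have h1 := hw.2 (fun t => g (t + (-h.2))) (a.comp (by fun_prop)) A b
      (by
        filter_upwards [ht.eventually d] with y hy
        have e3 : y.1 + -h.1 - z.1 = y.1 - (z.1 + h.1) := by abel
        simpa [e3] using hy)
    rw [deriv_comp_add_const (f := g)] at h1
    simpa using h1

lemma powC2 (A : ℝ) (m : ℕ) : ContDiff ℝ 2 (fun s : ℝ => A * s ^ m) := by fun_prop

lemma Bad.not_touch {c : ℝ} {w φ : En n × ℝ → ℝ} {z : En n × ℝ} (hm : 1 ≤ m)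
    (hφ : ContDiff ℝ 2 φ) (hb : Bad γ p m c φ z)
    (hw : SubAt γ p m c w z) (h : ∀ᶠ y in 𝓝 z, w y - φ y ≤ w z - φ z) : False := by
  rcases hb with ⟨h1, h2⟩ | ⟨g, A, hg, hA, hd, rfl⟩
  · have h3 := hw.1 (fun y => φ y + (fun _ => w z - φ z) y.2) (hφ.add contDiff_const)
      (by rw [sGrad_add_time φ (fun _ => w z - φ z)]; exact h1) (by simp)
      (by filter_upwards [h] with y hy; linarith)
    rw [opF_add_time φ (fun _ => w z - φ z), tD_add_time hφ contDiff_const] at h3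
    simp at h3
    linarith
  · have h3 := hw.2 g hg A hA (by
      filter_upwards [h] with y hy
      simp only [rad] at hy
      have h0 : A * (‖z.1 - z.1‖ ^ 2) ^ m = 0 := by
        have : m ≠ 0 := by omega
        simp [this]
      rw [h0] at hy
      linarith)
    linarith

lemma sGrad_pow_self (g : ℝ → ℝ) (A : ℝ) (y : En n) (t : ℝ) :
    sGrad (rad g (fun s => A * s ^ m) y) y t = 0 := by
  rw [sGrad_rad g ((powC2 A m).differentiable (by norm_num))]
  simp

lemma Bad.neg_sub {c : ℝ} {φ : En n × ℝ → ℝ} {z : En n × ℝ} (hp : 1 < p) (hm : 2 ≤ m)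
    (hφ : ContDiff ℝ 2 φ) (hb : Bad γ p m c φ z) : SubAt γ p m (-c) (fun y => - φ y) z := by
  have hg0 : ∀ g : ℝ → ℝ, ContDiff ℝ 2 g → ∀ A : ℝ,
      (∀ᶠ y in 𝓝 z, -φ y ≤ -φ z + (g y.2 - g z.2) + A * (‖y.1 - z.1‖ ^ 2) ^ m) →
      sGrad φ z.1 z.2 = 0 ∧ tD φ z = - deriv g z.2 := by
    intro g hg A h
    have hr := rad_contDiff hg (powC2 A m) z.1
    have hmin : IsLocalMin (fun y => φ y + rad g (fun s => A * s ^ m) z.1 y) z := by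
      filter_upwards [h] with y hy
      have : m ≠ 0 := by omega
      simp [rad, this]
      linarith
    have h1 := locmin_sGrad (hφ.add hr) hmin
    have h2 := locmin_tD (hφ.add hr) hmin
    rw [sGrad_add hφ hr, sGrad_pow_self, add_zero] at h1
    rw [tD_add hφ hr, tD_rad] at h2
    exact ⟨h1, by linarith⟩
  have hps : ∀ ψ : En n × ℝ → ℝ, ContDiff ℝ 2 ψ → ψ z = -φ z → (∀ᶠ y in 𝓝 z, -φ y ≤ ψ y) →
      IsLocalMin (fun y => φ y + ψ y) z := by
    intro ψ _ h1 h2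
    filter_upwards [h2] with y hy
    simp [h1]
    linarith
  rcases hb with ⟨h1, h2⟩ | ⟨g, A, hg, hA, hd, rfl⟩
  · constructor
    · intro ψ hψ hne heq hle
      have hmin := hps ψ hψ heq hle
      have a1 := locmin_sGrad (hφ.add hψ) hmin
      have a2 := locmin_tD (hφ.add hψ) hmin
      have a3 := locmin_sHess (hφ.add hψ) hmin
      rw [sGrad_add hφ hψ] at a1
      rw [tD_add hφ hψ] at a2
      rw [sHess_add hφ hψ] at a3
      have a4 := opVal_nonneg (γ := γ) hp h1 a3
      rw [opVal_add] at a4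
      have a5 : sGrad ψ z.1 z.2 = - sGrad φ z.1 z.2 := (neg_eq_of_add_eq_zero_right a1).symm
      unfold opF at *
      rw [a5, opVal_neg_left]
      linarith
    · intro g hg A hA h
      exact absurd (hg0 g hg A h).1 h1
  · constructor
    · intro ψ hψ hne heq hle
      have hmin := hps ψ hψ heq hle
      have a1 := locmin_sGrad (hφ.add hψ) hmin
      rw [sGrad_add hφ hψ, sGrad_pow_self, zero_add] at a1
      exact absurd a1 hne
    · intro g2 hg2 A2 hA2 h
      have := (hg0 g2 hg2 A2 h).2
      rw [tD_rad] at this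
      linarith

end subat


section strict
variable {n : ℕ} {γ p : ℝ} {m : ℕ}

lemma deriv_pow_h (A : ℝ) (m : ℕ) : deriv (fun s : ℝ => A * s ^ m) = fun s => A * (m * s ^ (m - 1)) := by
  funext s
  simp

lemma deriv2_pow_h (A : ℝ) (m : ℕ) (s : ℝ) :
    deriv (deriv (fun s : ℝ => A * s ^ m)) s = A * (m * ((m - 1 : ℕ) * s ^ (m - 1 - 1))) := by
  rw [deriv_pow_h]
  simp

/-- the operator on `A |x-y|^{2m}` is small near `y` -/
lemma pow_small (hγ : γ ∈ Set.Ioo (-1 : ℝ) 0) (hm : 2 ≤ m) (hm2 : 1 ≤ ((m : ℝ) - 1) * (1 + γ))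
    {A : ℝ} (hA : 0 < A) {κ : ℝ} (hκ : 0 < κ) :
    ∃ r > 0, ∀ (g : ℝ → ℝ) (y : En n) (z : En n × ℝ), z.1 ≠ y → ‖z.1 - y‖ < r →
      sGrad (rad g (fun s => A * s ^ m) y) z.1 z.2 ≠ 0 ∧
      opF γ p (rad g (fun s => A * s ^ m) y) z < κ := by
  set c1 : ℝ := 2 * (n + p - 2) + 4 * (p - 1) * (m - 1) with hc1
  set M : ℝ := 2 ^ γ * (A * m) ^ (1 + γ) * |c1| with hM
  have hM0 : 0 ≤ M := by positivity
  refine ⟨min 1 (κ / (M + 1)), by positivity, ?_⟩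
  intro g y z hzy hlt
  set l := ‖z.1 - y‖ with hl
  have hl0 : 0 < l := norm_pos_iff.2 (sub_ne_zero.2 hzy)
  have hl1 : l < 1 := hlt.trans_le (min_le_left _ _)
  have hl2 : l < κ / (M + 1) := hlt.trans_le (min_le_right _ _)
  have hmpos : (0 : ℝ) < m := by positivity
  have ha : deriv (fun s : ℝ => A * s ^ m) (l ^ 2) = A * (m * (l ^ 2) ^ (m - 1)) := by
    rw [deriv_pow_h]
  set a := A * (m * (l ^ 2) ^ (m - 1)) with hadef
  have ha0 : 0 < a := by positivity
  have hb : deriv (deriv (fun s : ℝ => A * s ^ m)) (l ^ 2) * l ^ 2 = (m - 1) * a := by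
    rw [deriv2_pow_h, hadef]
    obtain ⟨k, rfl⟩ : ∃ k, m = k + 2 := ⟨m - 2, by omega⟩
    simp only [show k + 2 - 1 = k + 1 by omega, show k + 1 - 1 = k by omega]
    push_cast
    ring
  constructor
  · rw [sGrad_rad g ((powC2 A m).differentiable (by norm_num)), ← hl, ha]
    exact smul_ne_zero (by positivity) (sub_ne_zero.2 hzy)
  · rw [opF_rad γ p g (powC2 A m) y z hzy (by rw [← hl, ha]; exact ha0.ne'), ← hl, ha]
    have e1 : 2 * a * (n + p - 2) + 4 * (p - 1) * deriv (deriv (fun s : ℝ => A * s ^ m)) (l ^ 2) * l ^ 2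
        = a * c1 := by
      rw [mul_assoc (4 * (p - 1)), hb, hc1]; ring
    rw [e1, norm_smul, ← hl, Real.norm_eq_abs, abs_of_pos (by positivity : 0 < 2 * a)]
    have e2 : (2 * a * l) ^ γ * a = 2 ^ γ * (A * m) ^ (1 + γ) * l ^ (2 * ((m : ℝ) - 1) * (1 + γ) + γ) := by
      rw [Real.mul_rpow (by positivity) hl0.le, Real.mul_rpow (by norm_num) ha0.le]
      have : a ^ γ * a = a ^ (1 + γ) := by
        rw [add_comm, Real.rpow_add ha0, Real.rpow_one]
      have h3 : a ^ (1 + γ) = (A * m) ^ (1 + γ) * l ^ (2 * ((m : ℝ) - 1) * (1 + γ)) := by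
        have : a = (A * m) * l ^ (2 * ((m : ℝ) - 1)) := by
          rw [hadef, ← pow_mul, ← Real.rpow_natCast]
          rw [Nat.cast_mul, Nat.cast_sub (by omega)]
          push_cast
          ring
        rw [this, Real.mul_rpow (by positivity) (by positivity), ← Real.rpow_mul hl0.le]
      calc 2 ^ γ * a ^ γ * l ^ γ * a = 2 ^ γ * (a ^ γ * a) * l ^ γ := by ring
        _ = _ := by rw [this, h3, Real.rpow_add hl0]; ring
    have e3 : l ^ (2 * ((m : ℝ) - 1) * (1 + γ) + γ) ≤ l := by
      have := Real.rpow_le_rpow_of_exponent_ge hl0 hl1.le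
        (show 1 ≤ 2 * ((m : ℝ) - 1) * (1 + γ) + γ by have := hγ.1; nlinarith)
      rwa [Real.rpow_one] at this
    calc (2 * a * l) ^ γ * (a * c1) = ((2 * a * l) ^ γ * a) * c1 := by ring
      _ ≤ ((2 * a * l) ^ γ * a) * |c1| := by
          gcongr
          exact le_abs_self _
      _ = (2 ^ γ * (A * m) ^ (1 + γ) * l ^ (2 * ((m : ℝ) - 1) * (1 + γ) + γ)) * |c1| := by rw [e2]
      _ ≤ (2 ^ γ * (A * m) ^ (1 + γ) * l) * |c1| := by gcongr
      _ = M * l := by rw [hM]; ring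
      _ ≤ (M + 1) * l := by nlinarith
      _ < (M + 1) * (κ / (M + 1)) := by gcongr
      _ = κ := by field_simp

/-- quartic perturbation -/
def pert (z0 : En n × ℝ) : En n × ℝ → ℝ := rad (fun t => (t - z0.2) ^ 4) (fun s => 1 * s ^ 2) z0.1

lemma pert_contDiff (z0 : En n × ℝ) : ContDiff ℝ 2 (pert z0) :=
  rad_contDiff (by fun_prop) (powC2 1 2) z0.1

lemma pert_nonneg (z0 z : En n × ℝ) : 0 ≤ pert z0 z := by
  unfold pert rad; positivity

lemma pert_self (z0 : En n × ℝ) : pert z0 z0 = 0 := by simp [pert, rad]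

lemma pert_ge {z0 z : En n × ℝ} {r : ℝ} (hr : 0 ≤ r) (h : r ≤ dist z z0) : r ^ 4 ≤ pert z0 z := by
  unfold pert rad
  rw [Prod.dist_eq, le_max_iff, dist_eq_norm, Real.dist_eq] at h
  rcases h with h | h
  · have : r ^ 4 ≤ ‖z.1 - z0.1‖ ^ 4 := by gcongr
    have h2 : 0 ≤ (z.2 - z0.2) ^ 4 := by positivity
    nlinarith
  · have : r ^ 4 ≤ |z.2 - z0.2| ^ 4 := by gcongr
    have h3 : |z.2 - z0.2| ^ 4 = (z.2 - z0.2) ^ 4 := by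
      rw [← abs_pow, abs_of_nonneg (by positivity)]
    have h2 : 0 ≤ 1 * (‖z.1 - z0.1‖ ^ 2) ^ 2 := by positivity
    linarith

lemma pert_jet (z0 : En n × ℝ) : sGrad (pert z0) z0.1 z0.2 = 0 ∧ sHess (pert z0) z0.1 z0.2 = 0 ∧
    tD (pert z0) z0 = 0 := by
  refine ⟨sGrad_pow_self _ _ _ _, ?_, ?_⟩
  · unfold pert
    rw [sHess_rad _ (powC2 1 2), deriv_pow_h]
    simp
    ext v; simp
  · unfold pert
    rw [tD_rad]
    have : HasDerivAt (fun t : ℝ => (t - z0.2) ^ 4) _ z0.2 := ((hasDerivAt_id z0.2).sub_const z0.2).pow 4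
    rw [this.deriv]
    simp

lemma add_pert_jet {φ : En n × ℝ → ℝ} (hφ : ContDiff ℝ 2 φ) (z0 : En n × ℝ) (B : ℝ) :
    ContDiff ℝ 2 (fun z => φ z + B * pert z0 z) ∧
    sGrad (fun z => φ z + B * pert z0 z) z0.1 z0.2 = sGrad φ z0.1 z0.2 ∧
    sHess (fun z => φ z + B * pert z0 z) z0.1 z0.2 = sHess φ z0.1 z0.2 ∧
    tD (fun z => φ z + B * pert z0 z) z0 = tD φ z0 := by
  have e : (fun z => B * pert z0 z) = rad (fun t => B * (t - z0.2) ^ 4) (fun s => B * s ^ 2) z0.1 := by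
    funext z; simp [pert, rad]; ring
  have hc : ContDiff ℝ 2 (fun z => B * pert z0 z) := contDiff_const.mul (pert_contDiff z0)
  refine ⟨hφ.add hc, ?_, ?_, ?_⟩
  · rw [sGrad_add hφ hc, e, sGrad_pow_self, add_zero]
  · rw [sHess_add hφ hc, e, sHess_rad _ (powC2 B 2), deriv_pow_h]
    simp
    ext v; simp
  · rw [tD_add hφ hc, e, tD_rad]
    have : HasDerivAt (fun t : ℝ => B * (t - z0.2) ^ 4) _ z0.2 :=
      (((hasDerivAt_id z0.2).sub_const z0.2).pow 4).const_mul B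
    rw [this.deriv]
    simp

lemma exists_strict (hγ : γ ∈ Set.Ioo (-1 : ℝ) 0) (hm : 2 ≤ m) (hm2 : 1 ≤ ((m : ℝ) - 1) * (1 + γ))
    {c : ℝ} {v : En n × ℝ → ℝ} {z0 : En n × ℝ} {U : Set (En n × ℝ)} (hU : U ∈ 𝓝 z0)
    (hns : ¬ SubAt γ p m c v z0) :
    ∃ (φ : En n × ℝ → ℝ) (r κ : ℝ), ContDiff ℝ 2 φ ∧ 0 < r ∧ 0 < κ ∧
      Metric.closedBall z0 r ⊆ U ∧ φ z0 = v z0 ∧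
      (∀ z ∈ Metric.closedBall z0 r, v z ≤ φ z ∧ Bad γ p m c φ z) ∧
      (∀ z ∈ Metric.sphere z0 r, v z + κ ≤ φ z) := by
  rw [SubAt, not_and_or] at hns
  rcases hns with h | h
  · push Not at h
    obtain ⟨φ, hφ, hne, heq, hle, hlt⟩ := h
    obtain ⟨a1, a2, a3, a4⟩ := add_pert_jet hφ z0 1
    set ψ : En n × ℝ → ℝ := fun z => φ z + 1 * pert z0 z with hψ
    have b1 : sGrad ψ z0.1 z0.2 ≠ 0 := by rw [a2]; exact hne
    have b2 : c < tD ψ z0 - opF γ p ψ z0 := by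
      unfold opF at *
      rw [a2, a3, a4]; exact hlt
    have b3 : ∀ᶠ z in 𝓝 z0, sGrad ψ z.1 z.2 ≠ 0 :=
      (sGrad_cont a1).continuousAt.eventually_ne b1
    have b4 : ∀ᶠ z in 𝓝 z0, c < tD ψ z - opF γ p ψ z :=
      ((tD_cont a1).continuousAt.sub (opF_continuousAt γ p a1 b1)).eventually_const_lt b2
    have b5 := (hle.and (b3.and b4)).and hU
    obtain ⟨r, hr, hb⟩ := Metric.nhds_basis_closedBall.mem_iff.1 b5
    refine ⟨ψ, r, r ^ 4, a1, hr, by positivity, fun z hz => (hb hz).2, ?_, ?_, ?_⟩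
    · simp [hψ, pert_self, heq]
    · intro z hz
      obtain ⟨⟨c1, c2, c3⟩, _⟩ := hb hz
      refine ⟨?_, Or.inl ⟨c2, c3⟩⟩
      have := pert_nonneg z0 z
      simp only [hψ]
      linarith
    · intro z hz
      obtain ⟨⟨c1, c2, c3⟩, _⟩ := hb (Metric.sphere_subset_closedBall hz)
      have := pert_ge hr.le (le_of_eq (Metric.mem_sphere.1 hz).symm)
      simp only [hψ]
      linarith
  · push Not at h
    obtain ⟨g, hg, A, hA, hle, hlt⟩ := h
    set G : ℝ → ℝ := fun t => (v z0 - g z0.2) + g t + (t - z0.2) ^ 4 with hG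
    have hGc : ContDiff ℝ 2 G := by
      simp only [hG]; fun_prop
    have hGd : deriv G z0.2 = deriv g z0.2 := by
      have h1 : HasDerivAt (fun t : ℝ => (t - z0.2) ^ 4) _ z0.2 := ((hasDerivAt_id z0.2).sub_const z0.2).pow 4
      have h2 := (((hg.differentiable (by norm_num)) z0.2).hasDerivAt.const_add (v z0 - g z0.2)).add h1
      refine h2.deriv.trans ?_
      simp
    set κ1 := (deriv g z0.2 - c) / 2 with hκ1
    have hkappa : 0 < κ1 := by rw [hκ1]; linarith
    obtain ⟨r1, hr1, hsm⟩ := pow_small (n := n) (p := p) hγ hm hm2 (show 0 < A + 1 by linarith) hkappa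
    have hGdc : Continuous (deriv G) := hGc.continuous_deriv (by norm_num)
    have b1 : ∀ᶠ z : En n × ℝ in 𝓝 z0, c + κ1 < deriv G z.2 := by
      have : ContinuousAt (fun z : En n × ℝ => deriv G z.2) z0 := (hGdc.comp continuous_snd).continuousAt
      refine this.eventually_const_lt ?_
      show c + κ1 < deriv G z0.2
      rw [hGd, hκ1]; linarith
    have b2 : ∀ᶠ z : En n × ℝ in 𝓝 z0, ‖z.1 - z0.1‖ < r1 := by
      have : ContinuousAt (fun z : En n × ℝ => ‖z.1 - z0.1‖) z0 := by fun_prop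
      refine this.eventually_lt_const ?_
      simpa using hr1
    have b5 := (hle.and (b1.and b2)).and hU
    obtain ⟨r, hr, hb⟩ := Metric.nhds_basis_closedBall.mem_iff.1 b5
    refine ⟨rad G (fun s => (A + 1) * s ^ m) z0.1, r, min (r ^ 4) (r ^ (2 * m)), ?_, hr, by positivity,
      fun z hz => (hb hz).2, ?_, ?_, ?_⟩
    · exact rad_contDiff hGc (powC2 _ _) _
    · have : m ≠ 0 := by omega
      simp [rad, hG, this]
    · intro z hz
      obtain ⟨⟨c1, c2, c3⟩, _⟩ := hb hz
      refine ⟨?_, ?_⟩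
      · simp only [rad, hG]
        have h1 : 0 ≤ (z.2 - z0.2) ^ 4 := by positivity
        have h2 : 0 ≤ (‖z.1 - z0.1‖ ^ 2) ^ m := by positivity
        linarith
      · by_cases hx : z.1 = z0.1
        · refine Or.inr ⟨G, A + 1, hGc, by linarith, by linarith, ?_⟩
          rw [hx]
        · obtain ⟨d1, d2⟩ := hsm G z0.1 z hx c3
          refine Or.inl ⟨d1, ?_⟩
          rw [tD_rad]
          linarith
    · intro z hz
      obtain ⟨⟨c1, c2, c3⟩, _⟩ := hb (Metric.sphere_subset_closedBall hz)
      simp only [rad, hG]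
      have h1 : 0 ≤ (z.2 - z0.2) ^ 4 := by positivity
      have h2 : 0 ≤ (‖z.1 - z0.1‖ ^ 2) ^ m := by positivity
      have h3 : min (r ^ 4) (r ^ (2 * m)) ≤ (z.2 - z0.2) ^ 4 + (‖z.1 - z0.1‖ ^ 2) ^ m := by
        have hd : max (dist z.1 z0.1) (dist z.2 z0.2) = r := (Metric.mem_sphere.1 hz)
        rcases max_choice (dist z.1 z0.1) (dist z.2 z0.2) with h | h
        · rw [h, dist_eq_norm] at hd
          rw [hd, ← pow_mul]
          exact (min_le_right _ _).trans (by linarith)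
        · rw [h, Real.dist_eq] at hd
          have h4 : (z.2 - z0.2) ^ 4 = r ^ 4 := by
            rw [← hd, ← abs_pow, abs_of_nonneg h1]
          rw [h4]
          exact (min_le_left _ _).trans (by linarith)
      linarith

/-- continuous suprema of continuous subsolutions are subsolutions -/
lemma visc_sup_sub (hγ : γ ∈ Set.Ioo (-1 : ℝ) 0) (hm : 2 ≤ m) (hm2 : 1 ≤ ((m : ℝ) - 1) * (1 + γ))
    {c : ℝ} {v : En n × ℝ → ℝ} {D : Set (En n × ℝ)} (hD : IsOpen D) (S : Set (En n × ℝ → ℝ))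
    (hS : ∀ w ∈ S, ContinuousOn w D ∧ ∀ z ∈ D, SubAt γ p m c w z)
    (hv : ∀ z ∈ D, ∀ w ∈ S, w z ≤ v z) (hv2 : ∀ z ∈ D, ∀ η > 0, ∃ w ∈ S, v z - η < w z)
    {z0 : En n × ℝ} (hz0 : z0 ∈ D) : SubAt γ p m c v z0 := by
  by_contra hns
  obtain ⟨φ, r, κ, hφ, hr, hκ, hsub, heq, hin, hsp⟩ := exists_strict hγ hm hm2 (hD.mem_nhds hz0) hns
  obtain ⟨w, hwS, hw⟩ := hv2 z0 hz0 κ hκ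
  have hcont : ContinuousOn (fun z => w z - φ z) (Metric.closedBall z0 r) :=
    ((hS w hwS).1.mono hsub).sub hφ.continuous.continuousOn
  obtain ⟨z1, hz1, hmax⟩ := (isCompact_closedBall z0 r).exists_isMaxOn
    ⟨z0, Metric.mem_closedBall_self hr.le⟩ hcont
  have h1 : w z0 - φ z0 ≤ w z1 - φ z1 := hmax (Metric.mem_closedBall_self hr.le)
  have hz1b : z1 ∈ Metric.ball z0 r := by
    rcases lt_or_eq_of_le (Metric.mem_closedBall.1 hz1) with h | h
    · exact h
    · have h2 := hsp z1 h
      have h3 := hv z1 (hsub hz1) w hwS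
      linarith
  refine Bad.not_touch (by omega) hφ (hin z1 hz1).2 ((hS w hwS).2 z1 (hsub hz1)) ?_
  filter_upwards [Metric.isOpen_ball.mem_nhds hz1b] with y hy
  exact hmax (Metric.ball_subset_closedBall hy)

end strict


section e1
variable {n : ℕ} {γ p : ℝ} {m : ℕ}

lemma e1_one {f u : En n × ℝ → ℝ} {Ω : Set (En n × ℝ)}
    (hb : Bornology.IsBounded Ω) {M : ℝ} (hM : ∀ z ∈ Ω, u z ≤ M) (hs : IsSubsol γ p f u Ω)
    {c : ℝ} (hf : ∀ z ∈ Ω, f z ≤ c) {z : En n × ℝ} (hz : z ∈ Ω) {φ : En n × ℝ → ℝ}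
    (hφ : ContDiff ℝ 2 φ) (hne : sGrad φ z.1 z.2 ≠ 0)
    (ht : ∀ᶠ y in 𝓝 z, u y - φ y ≤ u z - φ z) : tD φ z - opF γ p φ z ≤ c := by
  obtain ⟨r, hr, hball⟩ := Metric.eventually_nhds_iff_ball.1 ht
  obtain ⟨L, hL⟩ : ∃ L, ∀ y ∈ Ω, L ≤ φ y := by
    obtain ⟨L, hL⟩ := (hb.isCompact_closure.image hφ.continuous).bddBelow
    exact ⟨L, fun y hy => hL ⟨y, subset_closure hy, rfl⟩⟩
  set k := u z - φ z with hk
  set B := |M - L - k| / r ^ 4 with hB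
  have hB0 : 0 ≤ B := by positivity
  obtain ⟨a1, a2, a3, a4⟩ := add_pert_jet hφ z B
  set ψ : En n × ℝ → ℝ := fun y => φ y + B * pert z y with hψ
  have e0 : (fun y => ψ y + (fun _ : ℝ => k) y.2) = fun y => ψ y + k := rfl
  have h := hs.1 z hz (fun y => ψ y + (fun _ : ℝ => k) y.2) (a1.add contDiff_const)
    (by rw [sGrad_add_time ψ (fun _ => k), a2]; exact hne)
    (by simp [hψ, pert_self, hk])
    (by
      intro w hw
      simp only [hψ]
      by_cases hd : dist w z < r
      · have h1 := hball w hd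
        have h2 := mul_nonneg hB0 (pert_nonneg z w)
        linarith
      · push Not at hd
        have h1 := pert_ge hr.le hd
        have h2 : B * r ^ 4 ≤ B * pert z w := by gcongr
        have h3 : B * r ^ 4 = |M - L - k| := by rw [hB]; field_simp
        have h4 := le_abs_self (M - L - k)
        have := hM w hw
        have := hL w hw
        linarith)
  have h1 := tD_add_time (z := z) a1 (contDiff_const (c := k) (𝕜 := ℝ) (E := ℝ))
  have h2 := opF_add_time (γ := γ) (p := p) ψ (fun _ => k) z
  have h3 : tD (fun y => ψ y + (fun _ : ℝ => k) y.2) z - opF γ p (fun y => ψ y + (fun _ : ℝ => k) y.2) z ≤ f z := h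
  rw [h1, h2, a4] at h3
  simp at h3
  have h4 : opF γ p ψ z = opF γ p φ z := by unfold opF; rw [a2, a3]
  rw [h4] at h3
  linarith [hf z hz]

lemma const_of_holder {M : En n → ℝ} {x0 : En n} {ρ A : ℝ} {m : ℕ} (hm : 2 ≤ m)
    (h : ∀ x ∈ Metric.ball x0 ρ, ∀ y ∈ Metric.ball x0 ρ, M x - M y ≤ A * (‖x - y‖ ^ 2) ^ m) :
    ∀ x ∈ Metric.ball x0 ρ, ∀ y ∈ Metric.ball x0 ρ, M x = M y := by
  have hd : ∀ y ∈ Metric.ball x0 ρ, HasFDerivAt M (0 : En n →L[ℝ] ℝ) y := by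
    intro y hy
    have hO : (fun x => M x - M y) =O[𝓝 y] fun x => ‖x - y‖ ^ (2 * m) := by
      refine Asymptotics.IsBigO.of_bound A ?_
      filter_upwards [Metric.isOpen_ball.mem_nhds hy] with x hx
      have h1 := h x hx y hy
      have h2 := h y hy x hx
      rw [norm_sub_rev] at h2
      rw [Real.norm_eq_abs, Real.norm_eq_abs, abs_of_nonneg (by positivity : 0 ≤ ‖x - y‖ ^ (2 * m)), pow_mul]
      exact abs_le.2 ⟨by linarith, h1⟩
    have h3 := hO.hasFDerivAt (𝕜 := ℝ) (by omega)
    have h4 := h3.add_const (M y)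
    simpa using h4
  intro x hx y hy
  refine (convex_ball x0 ρ).is_const_of_fderivWithin_eq_zero (𝕜 := ℝ) (f := M)
    (fun z hz => (hd z hz).differentiableAt.differentiableWithinAt) ?_ hx hy
  intro z hz
  exact ((hd z hz).hasFDerivWithinAt).fderivWithin (Metric.isOpen_ball.uniqueDiffWithinAt hz)

lemma e1 (hγ : γ ∈ Set.Ioo (-1 : ℝ) 0) (hm : 2 ≤ m) (hm2 : 1 ≤ ((m : ℝ) - 1) * (1 + γ))
    {f u : En n × ℝ → ℝ} {Ω : Set (En n × ℝ)} (hΩ : IsOpen Ω)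
    (hb : Bornology.IsBounded Ω) (huc : ContinuousOn u Ω) {M : ℝ} (hM : ∀ z ∈ Ω, u z ≤ M)
    (hs : IsSubsol γ p f u Ω)
    {c : ℝ} (hf : ∀ z ∈ Ω, f z ≤ c) {z0 : En n × ℝ} (hz : z0 ∈ Ω) : SubAt γ p m c u z0 := by
  refine ⟨fun φ h1 h2 h3 h4 => e1_one hb hM hs hf hz h1 h2 ?_, ?_⟩
  · filter_upwards [h4] with y hy
    linarith
  intro g hg A hA hle
  by_contra hlt
  push Not at hlt
  set t0 := z0.2 with ht0
  set x0 := z0.1 with hx0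
  set G : ℝ → ℝ := fun t => g t + (t - t0) ^ 4 with hG
  have hGc : ContDiff ℝ 2 G := by simp only [hG]; fun_prop
  have hGd : deriv G t0 = deriv g t0 := by
    have h1 : HasDerivAt (fun t : ℝ => (t - t0) ^ 4) _ t0 := ((hasDerivAt_id t0).sub_const t0).pow 4
    have h2 := ((hg.differentiable (by norm_num)) t0).hasDerivAt.add h1
    refine h2.deriv.trans ?_
    simp
  set κ1 := (deriv g t0 - c) / 2 with hκ1
  have hkappa : 0 < κ1 := by rw [hκ1]; linarith
  obtain ⟨r1, hr1, hsm⟩ := pow_small (n := n) (p := p) hγ hm hm2 (show 0 < A + 1 by linarith) hkappa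
  have hGdc : Continuous (deriv G) := hGc.continuous_deriv (by norm_num)
  have b1 : ∀ᶠ z : En n × ℝ in 𝓝 z0, c + κ1 < deriv G z.2 := by
    have : ContinuousAt (fun z : En n × ℝ => deriv G z.2) z0 := (hGdc.comp continuous_snd).continuousAt
    refine this.eventually_const_lt ?_
    show c + κ1 < deriv G t0
    rw [hGd, hκ1]; linarith
  have b2 : ∀ᶠ z : En n × ℝ in 𝓝 z0, ‖z.1 - x0‖ < r1 / 2 := by
    have : ContinuousAt (fun z : En n × ℝ => ‖z.1 - x0‖) z0 := by fun_prop
    refine this.eventually_lt_const ?_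
    simpa [hx0] using hr1
  have b5 := (hle.and (b1.and b2)).and (hΩ.mem_nhds hz)
  obtain ⟨r, hr, hbr⟩ := Metric.nhds_basis_closedBall.mem_iff.1 b5
  set K := Metric.closedBall z0 r with hK
  set hh : En n → En n × ℝ → ℝ := fun y z => (A + 1) * (‖z.1 - y‖ ^ 2) ^ m with hhdef
  set F : En n → En n × ℝ → ℝ := fun y z => u z - rad G (fun s => (A + 1) * s ^ m) y z with hF
  have hm0 : m ≠ 0 := by omega
  have hFz0 : F x0 z0 = u z0 - G t0 := by simp [hF, rad, hx0, hm0, ht0]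
  set κ := min (r ^ 4) (r ^ (2 * m)) with hκ
  have hκ0 : 0 < κ := by positivity
  have hsp : ∀ z ∈ Metric.sphere z0 r, F x0 z + κ ≤ F x0 z0 := by
    intro z hz
    obtain ⟨⟨c1, c2, c3⟩, _⟩ := hbr (Metric.sphere_subset_closedBall hz)
    have h1 : 0 ≤ (z.2 - z0.2) ^ 4 := by positivity
    have h2 : 0 ≤ (‖z.1 - z0.1‖ ^ 2) ^ m := by positivity
    have h3 : min (r ^ 4) (r ^ (2 * m)) ≤ (z.2 - z0.2) ^ 4 + (‖z.1 - z0.1‖ ^ 2) ^ m := by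
      have hd : max (dist z.1 z0.1) (dist z.2 z0.2) = r := (Metric.mem_sphere.1 hz)
      rcases max_choice (dist z.1 z0.1) (dist z.2 z0.2) with h | h
      · rw [h, dist_eq_norm] at hd
        rw [hd, ← pow_mul]
        exact (min_le_right _ _).trans (by linarith)
      · rw [h, Real.dist_eq] at hd
        have h4 : (z.2 - z0.2) ^ 4 = r ^ 4 := by
          rw [← hd, ← abs_pow, abs_of_nonneg h1]
        rw [h4]
        exact (min_le_left _ _).trans (by linarith)
    rw [hFz0]
    simp only [hF, rad, hG]
    rw [← hx0] at *
    rw [← ht0] at *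
    simp
    linarith
  have hF0 : ∀ z ∈ K, F x0 z ≤ F x0 z0 := by
    intro z hz
    obtain ⟨⟨c1, c2, c3⟩, _⟩ := hbr hz
    have h1 : 0 ≤ (z.2 - t0) ^ 4 := by positivity
    have h2 : 0 ≤ (‖z.1 - x0‖ ^ 2) ^ m := by positivity
    rw [hFz0]
    simp only [hF, rad, hG]
    simp
    linarith
  -- uniform closeness
  have hun : ∀ᶠ y in 𝓝 x0, ∀ z ∈ K, |hh y z - hh x0 z| < κ / 3 := by
    refine (isCompact_closedBall z0 r).eventually_forall_of_forall_eventually ?_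
    intro z _
    have hc : Continuous (fun q : En n × (En n × ℝ) => |hh q.1 q.2 - hh x0 q.2|) := by
      simp only [hhdef]; fun_prop
    have := (hc.tendsto (x0, z)).eventually_lt_const (u := κ / 3) (by simp; positivity)
    exact this
  have hFh : ∀ y z, F y z = u z - G z.2 - hh y z := by
    intro y z; simp only [hF, rad, hhdef]; ring
  obtain ⟨ρ0, hρ0, hρ⟩ := Metric.eventually_nhds_iff_ball.1 hun
  set ρ := min ρ0 (min r (r1 / 2)) with hρdef
  have hρpos : 0 < ρ := by positivity
  have hz0K : z0 ∈ K := Metric.mem_closedBall_self hr.le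
  have hfC : ∀ y : En n, ContDiff ℝ 2 (rad G (fun s => (A + 1) * s ^ m) y) := fun y => rad_contDiff hGc (powC2 _ _) y
  have key : ∀ y ∈ Metric.ball x0 ρ, ∃ t ∈ Set.Ioo (t0 - r) (t0 + r), ∀ z ∈ K, F y z ≤ F y (y, t) := by
    intro y hy
    have hy0 : y ∈ Metric.ball x0 ρ0 := Metric.ball_subset_ball (min_le_left _ _) hy
    have hcont : ContinuousOn (F y) K :=
      (huc.mono fun z hz => (hbr hz).2).sub (hfC y).continuous.continuousOn
    obtain ⟨z1, hz1, hmax⟩ := (isCompact_closedBall z0 r).exists_isMaxOn ⟨z0, hz0K⟩ hcont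
    have hz1b : z1 ∈ Metric.ball z0 r := by
      rcases lt_or_eq_of_le (Metric.mem_closedBall.1 hz1) with h | h
      · exact h
      · have h2 := hsp z1 h
        have h3 := abs_lt.1 (hρ y hy0 z1 hz1)
        have h4 := abs_lt.1 (hρ y hy0 z0 hz0K)
        have h5 : F y z0 ≤ F y z1 := hmax hz0K
        rw [hFh, hFh] at h5 h2
        linarith
    have hz1e : z1.1 = y := by
      by_contra hne
      have hd : ‖z1.1 - y‖ < r1 := by
        have h1 := (hbr hz1).1.2.2
        have h2 : ‖y - x0‖ < r1 / 2 := by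
          have := Metric.mem_ball.1 hy
          rw [dist_eq_norm] at this
          exact this.trans_le ((min_le_right _ _).trans (min_le_right _ _))
        have h3 : z1.1 - y = (z1.1 - x0) - (y - x0) := by abel
        rw [h3]
        exact (norm_sub_le _ _).trans_lt (by linarith)
      obtain ⟨d1, d2⟩ := hsm G y z1 hne hd
      have h3 := e1_one hb hM hs hf (hbr hz1).2 (hfC y) d1 (by
        filter_upwards [Metric.isOpen_ball.mem_nhds hz1b] with w hw
        exact hmax (Metric.ball_subset_closedBall hw))
      rw [tD_rad] at h3
      have := (hbr hz1).1.2.1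
      linarith
    refine ⟨z1.2, ?_, ?_⟩
    · have : dist z1.2 z0.2 < r := (le_max_right _ _).trans_lt (Metric.mem_ball.1 hz1b)
      rw [Real.dist_eq, abs_lt] at this
      constructor <;> linarith [this.1, this.2]
    · intro z hz
      have h1 : F y z ≤ F y z1 := hmax hz
      have h2 : (y, z1.2) = z1 := by rw [← hz1e]
      rw [h2]
      exact h1
  choose! T hT1 hT2 using key
  have hmemK : ∀ y ∈ Metric.ball x0 ρ, ∀ t ∈ Set.Ioo (t0 - r) (t0 + r), (y, t) ∈ K := by
    intro y hy t ht
    rw [hK, Metric.mem_closedBall, Prod.dist_eq, max_le_iff]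
    refine ⟨?_, ?_⟩
    · have := Metric.mem_ball.1 hy
      exact this.le.trans ((min_le_right _ _).trans (min_le_left _ _))
    · rw [Real.dist_eq, abs_le]
      constructor <;> simp only [] <;> linarith [ht.1, ht.2]
  have hFyy : ∀ y t, F y (y, t) = u (y, t) - G t := by
    intro y t; simp [hF, rad, hm0]
  have hconst := const_of_holder (M := fun y => u (y, T y) - G (T y)) (x0 := x0) (ρ := ρ) (A := A + 1) hm (by
    intro x hx y hy
    have h1 := hT2 y hy (x, T x) (hmemK x hx _ (hT1 x hx))
    rw [hFyy, hFh] at h1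
    simp only [hhdef] at h1
    linarith)
  have hx0b : x0 ∈ Metric.ball x0 ρ := Metric.mem_ball_self hρpos
  have hfin := hs.2 z0 hz r hr (fun t => G t - G t0)
    ((hGc.of_le (by norm_num)).sub contDiff_const).contDiffOn (by simp [ht0])
    (by
      intro t ht
      have h1 := hF0 (x0, t) (hmemK x0 hx0b t ht)
      rw [hFyy, hFz0] at h1
      have : (z0.1, z0.2) = z0 := rfl
      rw [this, ← hx0]
      linarith)
    ⟨ρ, hρpos, u (x0, T x0) - G (T x0) + G t0, by
      intro x hx
      have hxb : x ∈ Metric.ball x0 ρ := by rw [Metric.mem_ball, dist_eq_norm]; exact hx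
      have e := hconst x hxb x0 hx0b
      rw [← e]
      refine IsGreatest.csSup_eq ⟨⟨T x, hT1 x hxb, by ring⟩, ?_⟩
      rintro _ ⟨t, ht, rfl⟩
      have h1 := hT2 x hxb (x, t) (hmemK x hxb t ht)
      rw [hFyy, hFyy] at h1
      simp only
      linarith⟩
  have h2 : deriv (fun t => G t - G t0) z0.2 = deriv G t0 := by
    rw [deriv_sub_const]
  rw [h2, hGd] at hfin
  linarith [hf z0 hz]

lemma sGrad_neg (φ : En n × ℝ → ℝ) (x : En n) (t : ℝ) :
    sGrad (fun z => - φ z) x t = - sGrad φ x t := by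
  simp only [sGrad, gradient, fderiv_fun_neg, map_neg]

lemma sHess_neg (φ : En n × ℝ → ℝ) (x : En n) (t : ℝ) :
    sHess (fun z => - φ z) x t = - sHess φ x t := by
  simp only [sHess, sGrad_neg, fderiv_fun_neg]

lemma sSup_neg_image (s : Set ℝ) (a : ℝ → ℝ) : sSup ((fun t => - a t) '' s) = - sInf (a '' s) := by
  have : (fun t => - a t) '' s = - (a '' s) := by
    rw [← Set.image_neg_eq_neg, Set.image_image]
  rw [this, Real.sSup_neg]

lemma super_neg {f u : En n × ℝ → ℝ} {Ω : Set (En n × ℝ)} :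
    IsSupersol γ p f u Ω ↔ IsSubsol γ p (fun z => - f z) (fun z => - u z) Ω := by
  have hop : ∀ (φ : En n × ℝ → ℝ) (z : En n × ℝ),
      deriv (fun s => - φ (z.1, s)) z.2 - opVal γ p (sGrad (fun z => - φ z) z.1 z.2) (sHess (fun z => - φ z) z.1 z.2)
      = - (deriv (fun s => φ (z.1, s)) z.2 - opVal γ p (sGrad φ z.1 z.2) (sHess φ z.1 z.2)) := by
    intro φ z
    rw [sGrad_neg, sHess_neg, opVal_neg_neg, deriv.fun_neg]; ring
  constructor
  · rintro ⟨h1, h2⟩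
    refine ⟨?_, ?_⟩
    · intro z hz φ hφ hne heq hle
      have := h1 z hz (fun y => - φ y) hφ.neg (by rw [sGrad_neg]; exact neg_ne_zero.2 hne)
        (by simp [heq]) (fun w hw => by have := hle w hw; linarith)
      rw [hop] at this
      linarith
    · intro z hz δ hδ φ hφ h0 hle hc
      have := h2 z hz δ hδ (fun t => - φ t) hφ.neg (by simp [h0])
        (fun t ht => by have := hle t ht; linarith) (by
          obtain ⟨ε, hε, c, hc⟩ := hc
          refine ⟨ε, hε, -c, fun x hx => ?_⟩
          rw [← hc x hx, eq_neg_iff_add_eq_zero, ← sub_neg_eq_add, sub_eq_zero, ← neg_neg (sInf _), ← sSup_neg_image]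
          congr 3
          funext t; ring)
      rw [deriv.fun_neg] at this
      linarith
  · rintro ⟨h1, h2⟩
    refine ⟨?_, ?_⟩
    · intro z hz φ hφ hne heq hle
      have := h1 z hz (fun y => - φ y) hφ.neg (by rw [sGrad_neg]; exact neg_ne_zero.2 hne)
        (by simp [heq]) (fun w hw => by have := hle w hw; linarith)
      rw [hop] at this
      linarith
    · intro z hz δ hδ φ hφ h0 hle hc
      have := h2 z hz δ hδ (fun t => - φ t) hφ.neg (by simp [h0])
        (fun t ht => by have := hle t ht; linarith) (by
          obtain ⟨ε, hε, c, hc⟩ := hc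
          refine ⟨ε, hε, -c, fun x hx => ?_⟩
          rw [← hc x hx, ← sSup_neg_image]
          congr 2
          funext t; ring)
      rw [deriv.fun_neg] at this
      linarith

end e1


/-- smooth step from `0` (for `t ≤ a`) to `N` (for `t ≥ a + s`) -/
def stepF (N a s t : ℝ) : ℝ := N * Real.smoothTransition ((t - a) / s)

lemma stepF_contDiff (N a s : ℝ) : ContDiff ℝ 2 (stepF N a s) := by
  have h : ContDiff ℝ 2 Real.smoothTransition := Real.smoothTransition.contDiff (n := 2)
  have h2 : ContDiff ℝ 2 (fun t : ℝ => (t - a) / s) := by fun_prop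
  exact contDiff_const.mul (h.comp h2)

lemma stepF_mono {N s : ℝ} (a : ℝ) (hN : 0 ≤ N) (hs : 0 < s) : Monotone (stepF N a s) := by
  intro x y hxy
  unfold stepF
  have : (x - a) / s ≤ (y - a) / s := by gcongr
  have := Real.smoothTransition.monotone this
  gcongr

lemma stepF_deriv {N s : ℝ} (a : ℝ) (hN : 0 ≤ N) (hs : 0 < s) (t : ℝ) : 0 ≤ deriv (stepF N a s) t :=
  (stepF_mono a hN hs).deriv_nonneg

lemma stepF_zero {N a s t : ℝ} (hs : 0 < s) (h : t ≤ a) : stepF N a s t = 0 := by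
  unfold stepF
  rw [Real.smoothTransition.zero_of_nonpos (div_nonpos_of_nonpos_of_nonneg (by linarith) hs.le), mul_zero]

lemma stepF_one {N a s t : ℝ} (hs : 0 < s) (h : a + s ≤ t) : stepF N a s t = N := by
  unfold stepF
  rw [Real.smoothTransition.one_of_one_le (by rw [le_div_iff₀ hs]; linarith), mul_one]

lemma stepF_nonneg {N : ℝ} (a s : ℝ) (hN : 0 ≤ N) (t : ℝ) : 0 ≤ stepF N a s t :=
  mul_nonneg hN (Real.smoothTransition.nonneg _)

section e2
variable {n : ℕ} {γ p : ℝ} {m : ℕ}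

lemma pCyl_isOpen (R : ℝ) : IsOpen (pCyl n R) := by
  have h1 : IsOpen {z : En n × ℝ | ‖z.1‖ < R} := isOpen_lt (by fun_prop) (by fun_prop)
  have h2 : IsOpen {z : En n × ℝ | z.2 ∈ Set.Ioo (-R ^ 2) (0 : ℝ)} := isOpen_Ioo.preimage continuous_snd
  exact h1.inter h2

lemma pCyl_bounded (R : ℝ) : Bornology.IsBounded (pCyl n R) := by
  refine ((Metric.isBounded_ball (x := (0 : En n)) (r := R)).prod
    (Metric.isBounded_Ioo (-R ^ 2) (0 : ℝ))).subset ?_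
  rintro z ⟨h1, h2⟩
  exact ⟨by simpa using h1, h2⟩

lemma e2 (hγ : γ ∈ Set.Ioo (-1 : ℝ) 0) (hm : 2 ≤ m) (hm2 : 1 ≤ ((m : ℝ) - 1) * (1 + γ))
    {R : ℝ} {V : En n × ℝ → ℝ} {M : ℝ}
    (hVc : ContinuousOn V (pCyl n R)) (hM : ∀ z ∈ pCyl n R, |V z| ≤ M)
    (hS : ∀ z ∈ pCyl n R, SubAt γ p m 0 V z)
    (h0 : ∀ x : En n, ∀ B : ℝ, ∀ e > 0, ∃ t ∈ Set.Ioo 0 e, B < V (x, t))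
    (hT : ∀ x : En n, ∀ B : ℝ, ∀ e > 0, ∃ t ∈ Set.Ioo (-R ^ 2 - e) (-R ^ 2), B < V (x, t)) :
    IsSubsol γ p (fun _ => 0) V (pCyl n R) := by
  refine ⟨fun z hz φ hφ hne heq hle => (hS z hz).1 φ hφ hne heq ?_, ?_⟩
  · filter_upwards [(pCyl_isOpen R).mem_nhds hz] with y hy using hle y hy
  rintro ⟨x0, t0⟩ hz δ hδ φ hφ hφ0 hle ⟨ε, hε, c, hc⟩
  simp only at hφ hφ0 hle hc ⊢
  obtain ⟨hx0, ht0⟩ := hz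
  simp only at hx0 ht0
  have hz0 : (x0, t0) ∈ pCyl n R := ⟨hx0, ht0⟩
  -- window inside
  have hnb : ∀ τ ∈ Set.Ioo (t0 - δ) (t0 + δ), ∃ e > 0, ∀ t, |t - τ| < e → V (x0, t) ≤ V (x0, t0) + φ τ + 1 := by
    intro τ hτ
    have hcont : ContinuousAt φ τ := (hφ.continuousOn).continuousAt (Ioo_mem_nhds hτ.1 hτ.2)
    have h1 := (hcont.eventually_lt_const (show φ τ < φ τ + 1 by linarith)).and (Ioo_mem_nhds hτ.1 hτ.2)
    obtain ⟨e, he, h2⟩ := Metric.eventually_nhds_iff.1 h1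
    refine ⟨e, he, fun t ht => ?_⟩
    obtain ⟨h3, h4⟩ := h2 (y := t) (by rw [Real.dist_eq]; exact ht)
    have := hle t h4
    linarith
  have hw1 : t0 + δ ≤ 0 := by
    by_contra hcon
    push Not at hcon
    obtain ⟨e, he, h2⟩ := hnb 0 ⟨by linarith [ht0.2], hcon⟩
    obtain ⟨t, ht, h3⟩ := h0 x0 (V (x0, t0) + φ 0 + 1) e he
    have := h2 t (by rw [sub_zero, abs_of_pos ht.1]; exact ht.2)
    linarith
  have hw2 : -R ^ 2 ≤ t0 - δ := by
    by_contra hcon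
    push Not at hcon
    obtain ⟨e, he, h2⟩ := hnb (-R ^ 2) ⟨hcon, by linarith [ht0.1]⟩
    obtain ⟨t, ht, h3⟩ := hT x0 (V (x0, t0) + φ (-R ^ 2) + 1) e he
    have := h2 t (by rw [abs_lt]; constructor <;> linarith [ht.1, ht.2])
    linarith
  have hwin : ∀ x : En n, ‖x‖ < R → ∀ t ∈ Set.Ioo (t0 - δ) (t0 + δ), (x, t) ∈ pCyl n R :=
    fun x hx t ht => ⟨hx, by linarith [ht.1], by linarith [ht.2]⟩
  have ht0w : t0 ∈ Set.Ioo (t0 - δ) (t0 + δ) := ⟨by linarith, by linarith⟩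
  have hcV : V (x0, t0) = c := by
    rw [← hc x0 (by simpa using hε)]
    symm
    refine IsGreatest.csSup_eq ⟨⟨t0, ht0w, by simp [hφ0]⟩, ?_⟩
    rintro _ ⟨t, ht, rfl⟩
    exact hle t ht
  have hup : ∀ x : En n, ‖x - x0‖ < ε → ‖x‖ < R → ∀ t ∈ Set.Ioo (t0 - δ) (t0 + δ),
      V (x, t) ≤ V (x0, t0) + φ t := by
    intro x hx hxR t ht
    have hbd : BddAbove ((fun t => V (x, t) - φ t) '' Set.Ioo (t0 - δ) (t0 + δ)) := by
      refine ⟨3 * M, ?_⟩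
      rintro _ ⟨t', ht', rfl⟩
      have h1 := hle t' ht'
      have h2 := abs_le.1 (hM _ (hwin x hxR t' ht'))
      have h3 := abs_le.1 (hM _ (hwin x0 hx0 t' ht'))
      have h4 := abs_le.1 (hM _ hz0)
      simp only
      linarith [h2.2, h3.1, h4.2]
    have h1 := le_csSup hbd ⟨t, ht, rfl⟩
    rw [hc x hx, ← hcV] at h1
    simp only at h1
    linarith
  -- main contradiction
  by_contra hpos
  push Not at hpos
  set a := deriv φ t0 with ha
  have hder : HasDerivAt φ a t0 :=
    ((hφ.differentiableOn (by norm_num)).differentiableAt (Ioo_mem_nhds ht0w.1 ht0w.2)).hasDerivAt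
  have hlo := (hasDerivAt_iff_isLittleO.1 hder).bound (show 0 < a / 4 by positivity)
  obtain ⟨r1, hr1, hsm⟩ := pow_small (n := n) (p := p) hγ hm hm2 (show (0 : ℝ) < 1 by norm_num)
    (show 0 < a / 2 by positivity)
  obtain ⟨r2, hr2, hder2⟩ := Metric.eventually_nhds_iff.1 hlo
  obtain ⟨r, hr, hrr⟩ : ∃ r > 0, r < r1 ∧ r < r2 ∧ r < δ ∧ r < ε ∧ r < R - ‖x0‖ := by
    have : 0 < R - ‖x0‖ := by linarith
    have h5 : 0 < min r1 (min r2 (min δ (min ε (R - ‖x0‖)))) := by positivity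
    obtain ⟨r, h6, h7⟩ := exists_between h5
    simp only [lt_min_iff] at h7
    exact ⟨r, h6, h7⟩
  obtain ⟨q1, q2, q3, q4, q5⟩ := hrr
  set s := min r (r ^ (2 * m) / a) with hs
  have hs0 : 0 < s := by positivity
  have hsr : s ≤ r := min_le_left _ _
  have hsa : a * s ≤ r ^ (2 * m) := by
    have : s ≤ r ^ (2 * m) / a := min_le_right _ _
    rw [le_div_iff₀ hpos] at this
    linarith
  set g : ℝ → ℝ := fun t => a / 2 * (t - t0) + stepF (a * s) t0 s t with hg
  have hN : 0 ≤ a * s := by positivity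
  have hgC : ContDiff ℝ 2 g := by
    have := stepF_contDiff (a * s) t0 s
    simp only [hg]; fun_prop
  have hgd : ∀ t, a / 2 ≤ deriv g t := by
    intro t
    have h1 : HasDerivAt (fun t : ℝ => a / 2 * (t - t0)) (a / 2 * 1) t :=
      ((hasDerivAt_id t).sub_const t0).const_mul _
    have h2 := ((stepF_contDiff (a * s) t0 s).differentiable (by norm_num) t).hasDerivAt
    have h3 := (h1.add h2).deriv
    have h4 : deriv g t = _ := h3
    rw [h4]
    have := stepF_deriv t0 hN hs0 t
    linarith
  set ψ : En n × ℝ → ℝ := rad g (fun s => 1 * s ^ m) x0 with hψ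
  have hψC : ContDiff ℝ 2 ψ := rad_contDiff hgC (powC2 _ _) x0
  set K : Set (En n × ℝ) := Metric.closedBall x0 r ×ˢ Set.Icc (t0 - r) (t0 + s) with hK
  have hKc : IsCompact K := (isCompact_closedBall _ _).prod isCompact_Icc
  have hKD : ∀ z ∈ K, z ∈ pCyl n R ∧ ‖z.1 - x0‖ ≤ r ∧ z.2 ∈ Set.Icc (t0 - r) (t0 + s) ∧
      V z ≤ V (x0, t0) + φ z.2 := by
    rintro ⟨x, t⟩ ⟨h1, h2⟩
    have h1' : ‖x - x0‖ ≤ r := by rw [← dist_eq_norm]; exact h1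
    have h3 : ‖x‖ < R := by
      have : x = (x - x0) + x0 := by abel
      rw [this]
      exact (norm_add_le _ _).trans_lt (by linarith)
    have h4 : t ∈ Set.Ioo (t0 - δ) (t0 + δ) := ⟨by linarith [h2.1], by linarith [h2.2]⟩
    exact ⟨hwin x h3 t h4, h1', h2, hup x (by linarith) h3 t h4⟩
  have hz0K : (x0, t0) ∈ K := ⟨Metric.mem_closedBall_self hr.le, by constructor <;> simp <;> linarith⟩
  have hψ0 : ψ (x0, t0) = 0 := by
    have : m ≠ 0 := by omega
    simp [hψ, rad, hg, this, stepF_zero hs0 (le_refl t0)]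
  have hφb : ∀ t ∈ Set.Icc (t0 - r) (t0 + s), |φ t - a * (t - t0)| ≤ a / 4 * |t - t0| := by
    intro t ht
    have := hder2 (y := t) (by rw [Real.dist_eq, abs_lt]; constructor <;> linarith [ht.1, ht.2])
    simp only [Real.norm_eq_abs, hφ0, sub_zero, smul_eq_mul] at this
    rwa [mul_comm a]
  have hφlow : ∀ t ∈ Set.Icc (t0 - r) (t0 + s), t ≤ t0 → φ t - g t ≤ a / 4 * (t - t0) := by
    intro t ht htt
    have h1 := (abs_le.1 (hφb t ht)).2
    rw [abs_of_nonpos (by linarith)] at h1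
    simp only [hg, stepF_zero hs0 htt]
    linarith
  have hφhigh : ∀ t ∈ Set.Icc (t0 - r) (t0 + s), t0 ≤ t → φ t - g t ≤ 3 / 4 * (a * s) - stepF (a * s) t0 s t := by
    intro t ht htt
    have h1 := (abs_le.1 (hφb t ht)).2
    rw [abs_of_nonneg (by linarith)] at h1
    simp only [hg]
    have : a * (t - t0) ≤ a * s := by gcongr; linarith [ht.2]
    linarith
  obtain ⟨z1, hz1, hmax⟩ := hKc.exists_isMaxOn ⟨_, hz0K⟩
    ((hVc.mono fun z hz => (hKD z hz).1).sub hψC.continuous.continuousOn)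
  obtain ⟨e1, e2, e3, e4⟩ := hKD z1 hz1
  have hmax0 : V (x0, t0) ≤ V z1 - ψ z1 := by
    have h1 : V (x0, t0) - ψ (x0, t0) ≤ V z1 - ψ z1 := hmax hz0K
    linarith
  have hψv : ψ z1 = g z1.2 + ‖z1.1 - x0‖ ^ (2 * m) := by
    simp [hψ, rad, pow_mul]
  have hnn : 0 ≤ ‖z1.1 - x0‖ ^ (2 * m) := by positivity
  have i1 : ‖z1.1 - x0‖ < r := by
    refine lt_of_le_of_ne e2 fun he => ?_
    have hrp : 0 < r ^ (2 * m) := by positivity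
    rw [he] at hψv
    rcases le_total z1.2 t0 with h | h
    · have := hφlow _ e3 h
      have h2 : a / 4 * (z1.2 - t0) ≤ 0 := mul_nonpos_of_nonneg_of_nonpos (by positivity) (by linarith)
      linarith
    · have := hφhigh _ e3 h
      have := stepF_nonneg t0 s hN z1.2
      linarith
  have i2 : t0 - r < z1.2 := by
    refine lt_of_le_of_ne e3.1 fun he => ?_
    have h1 := hφlow _ e3 (by linarith)
    rw [← he] at h1
    have : 0 < a * r := by positivity
    rw [← he] at e4 hψv
    linarith
  have i3 : z1.2 < t0 + s := by
    refine lt_of_le_of_ne e3.2 fun he => ?_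
    have h1 := hφhigh _ e3 (by linarith)
    rw [stepF_one hs0 he.ge] at h1
    have : 0 < a * s := by positivity
    linarith
  have hbad : Bad γ p m 0 ψ z1 := by
    by_cases hx : z1.1 = x0
    · refine Or.inr ⟨g, 1, hgC, by norm_num, ?_, by rw [hx]⟩
      have := hgd z1.2
      linarith
    · obtain ⟨d1, d2⟩ := hsm g x0 z1 hx (i1.trans q1)
      refine Or.inl ⟨d1, ?_⟩
      have := hgd z1.2
      rw [hψ, tD_rad]
      linarith
  refine Bad.not_touch (by omega) hψC hbad (hS z1 e1) ?_
  have hnhds : Metric.ball x0 r ×ˢ Set.Ioo (t0 - r) (t0 + s) ∈ 𝓝 z1 :=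
    (Metric.isOpen_ball.prod isOpen_Ioo).mem_nhds ⟨by rw [Metric.mem_ball, dist_eq_norm]; exact i1, i2, i3⟩
  filter_upwards [hnhds] with y hy
  exact hmax (show y ∈ K from ⟨Metric.ball_subset_closedBall hy.1, Ioo_subset_Icc_self hy.2⟩)

end e2


section barrier

/-- standing assumptions -/
structure Dat (n : ℕ) (γ p : ℝ) (m : ℕ) (R ε : ℝ) (u : En n × ℝ → ℝ) : Prop where
  hn : 1 ≤ n
  hγ : γ ∈ Set.Ioo (-1 : ℝ) 0
  hp : 1 < p
  hm : 2 ≤ m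
  hm2 : 1 ≤ ((m : ℝ) - 1) * (1 + γ)
  hR : 0 < R
  hR1 : R < 1
  hε : 0 < ε
  hε1 : ε ≤ 1
  hu : ContinuousOn u (pCyl n 1)
  hosc : ∀ z ∈ pCyl n 1, ∀ w ∈ pCyl n 1, u z - u w ≤ 1
  hsub : ∀ z ∈ pCyl n 1, SubAt γ p m ε u z
  hsup : ∀ z ∈ pCyl n 1, SubAt γ p m ε (fun y => - u y) z

/-- cylinder including the lateral boundary -/
def Dl (n : ℕ) (R : ℝ) : Set (En n × ℝ) := {z | ‖z.1‖ ≤ R ∧ z.2 ∈ Set.Ioo (-R ^ 2) (0 : ℝ)}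

/-- compact cylinder -/
def Kc (n : ℕ) (R s : ℝ) : Set (En n × ℝ) := {z | ‖z.1‖ ≤ R ∧ z.2 ∈ Set.Icc (-R ^ 2) (-s)}

/-- compact lateral boundary -/
def Ks (n : ℕ) (R s : ℝ) : Set (En n × ℝ) := {z | ‖z.1‖ = R ∧ z.2 ∈ Set.Icc (-R ^ 2) (-s)}

lemma Kc_compact (n : ℕ) (R s : ℝ) : IsCompact (Kc n R s) := by
  have : Kc n R s = Metric.closedBall (0 : En n) R ×ˢ Set.Icc (-R ^ 2) (-s) := by
    ext z; simp [Kc]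
  rw [this]
  exact (isCompact_closedBall _ _).prod isCompact_Icc

lemma Ks_compact (n : ℕ) (R s : ℝ) : IsCompact (Ks n R s) := by
  have : Ks n R s = Metric.sphere (0 : En n) R ×ˢ Set.Icc (-R ^ 2) (-s) := by
    ext z; simp [Ks]
  rw [this]
  exact (isCompact_sphere _ _).prod isCompact_Icc

lemma Ks_sub_Kc {n : ℕ} {R s : ℝ} {z : En n × ℝ} (h : z ∈ Ks n R s) : z ∈ Kc n R s := ⟨h.1.le, h.2⟩

variable {n : ℕ} {γ p : ℝ} {m : ℕ} {R ε : ℝ} {u : En n × ℝ → ℝ}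

lemma Dat.Kc_sub (H : Dat n γ p m R ε u) {s : ℝ} (hs : 0 < s) {z : En n × ℝ} (hz : z ∈ Kc n R s) :
    z ∈ pCyl n 1 := by
  have h1 := H.hR1
  have h2 := H.hR
  refine ⟨hz.1.trans_lt h1, ?_, ?_⟩
  · have := hz.2.1
    nlinarith
  · have := hz.2.2
    linarith

lemma Dat.Dl_sub (H : Dat n γ p m R ε u) {z : En n × ℝ} (hz : z ∈ Dl n R) : z ∈ pCyl n 1 := by
  have h1 := H.hR1
  have h2 := H.hR
  refine ⟨hz.1.trans_lt h1, ?_, hz.2.2⟩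
  have := hz.2.1
  nlinarith

lemma D_sub_Dl {z : En n × ℝ} (hz : z ∈ pCyl n R) : z ∈ Dl n R := ⟨hz.1.le, hz.2⟩

/-- spatial profile of the barrier -/
def bh (C k R : ℝ) (σ : ℝ) : ℝ := C * (Real.exp (-(k * R ^ 2)) - Real.exp (-(k * σ)))

lemma bh_contDiff (C k R : ℝ) : ContDiff ℝ 2 (bh C k R) := by
  unfold bh; fun_prop

lemma bh_hasDeriv (C k R σ : ℝ) : HasDerivAt (bh C k R) (C * (k * Real.exp (-(k * σ)))) σ := by
  have h1 : HasDerivAt (fun σ : ℝ => -(k * σ)) (-(k * 1)) σ := ((hasDerivAt_id σ).const_mul k).neg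
  have h2 := (h1.exp.const_sub (Real.exp (-(k * R ^ 2)))).const_mul C
  refine h2.congr_deriv ?_
  ring

lemma bh_deriv (C k R : ℝ) : deriv (bh C k R) = fun σ => C * (k * Real.exp (-(k * σ))) :=
  funext fun σ => (bh_hasDeriv C k R σ).deriv

lemma bh_deriv2 (C k R σ : ℝ) : deriv (deriv (bh C k R)) σ = - k * (C * (k * Real.exp (-(k * σ)))) := by
  rw [bh_deriv]
  have h1 : HasDerivAt (fun σ : ℝ => -(k * σ)) (-(k * 1)) σ := ((hasDerivAt_id σ).const_mul k).neg
  have h2 := (h1.exp.const_mul k).const_mul C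
  rw [h2.deriv]
  ring

lemma bgeom {x x0 : En n} (hx0 : ‖x0‖ = R) (hx : ‖x‖ ≤ R) :
    R ≤ ‖x - (2 : ℝ) • x0‖ ∧ ‖x - (2 : ℝ) • x0‖ ≤ 3 * R ∧
    R ^ 2 + ‖x - x0‖ ^ 2 ≤ ‖x - (2 : ℝ) • x0‖ ^ 2 := by
  have h2 : ‖(2 : ℝ) • x0‖ = 2 * R := by rw [norm_smul, hx0]; simp
  refine ⟨?_, ?_, ?_⟩
  · have := norm_sub_norm_le ((2 : ℝ) • x0) x
    rw [norm_sub_rev] at this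
    linarith
  · have := norm_sub_le x ((2 : ℝ) • x0)
    linarith
  · have e1 : x - (2 : ℝ) • x0 = (x - x0) - x0 := by rw [two_smul]; abel
    rw [e1, norm_sub_sq_real (x - x0) x0, inner_sub_left, real_inner_self_eq_norm_sq, hx0]
    have := real_inner_le_norm x x0
    rw [hx0] at this
    have hR : 0 ≤ R := (norm_nonneg x).trans hx
    nlinarith

lemma bad_barrier (hγ : γ ∈ Set.Ioo (-1 : ℝ) 0) (hp : 1 < p) (hR : 0 < R) (hR1 : R < 1) (K : ℝ) :
    ∃ k > 0, ∃ C0 > 0, ∀ C ≥ C0, ∀ g : ℝ → ℝ, ∀ x0 : En n, ‖x0‖ = R → ∀ z ∈ pCyl n R,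
      - K ≤ deriv g z.2 → Bad γ p m 0 (rad g (bh C k R) ((2 : ℝ) • x0)) z := by
  obtain ⟨k, hk, hk2⟩ : ∃ k > 0, 2 * (n + p - 2) + 1 ≤ 4 * (p - 1) * k * R ^ 2 := by
    refine ⟨(2 * |n + p - 2| + 1) / (4 * (p - 1) * R ^ 2), ?_, ?_⟩
    · have : 0 < p - 1 := by linarith
      positivity
    · have : 0 < p - 1 := by linarith
      have e : 4 * (p - 1) * ((2 * |n + p - 2| + 1) / (4 * (p - 1) * R ^ 2)) * R ^ 2 = 2 * |(n:ℝ) + p - 2| + 1 := by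
        field_simp
      rw [e]
      linarith [le_abs_self ((n : ℝ) + p - 2)]
  have h1γ : 0 < 1 + γ := by linarith [hγ.1]
  obtain ⟨C0, hC0, hC0'⟩ : ∃ C0 > 0, ∀ C ≥ C0, K < (6 : ℝ) ^ γ * (C * (k * Real.exp (-(k * (9 * R ^ 2))))) ^ (1 + γ) := by
    have hpos : 0 < k * Real.exp (-(k * (9 * R ^ 2))) := by positivity
    have t1 : Tendsto (fun C : ℝ => C * (k * Real.exp (-(k * (9 * R ^ 2))))) atTop atTop :=
      tendsto_id.atTop_mul_const hpos
    have t2 := (tendsto_rpow_atTop h1γ).comp t1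
    have t3 := t2.const_mul_atTop (show (0 : ℝ) < 6 ^ γ by positivity)
    obtain ⟨C0, h⟩ := eventually_atTop.1 (t3.eventually_gt_atTop K)
    exact ⟨max C0 1, by positivity, fun C hC => h C ((le_max_left _ _).trans hC)⟩
  refine ⟨k, hk, C0, hC0, ?_⟩
  intro C hC g x0 hx0 z hz hg
  have hCp : 0 < C := hC0.trans_le hC
  obtain ⟨b1, b2, b3⟩ := bgeom hx0 hz.1.le
  set ρ := ‖z.1 - (2 : ℝ) • x0‖ with hρ
  have hρ0 : 0 < ρ := hR.trans_le b1
  have hne : z.1 ≠ (2 : ℝ) • x0 := by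
    intro h
    rw [hρ, h] at hρ0
    simp at hρ0
  set a := C * (k * Real.exp (-(k * ρ ^ 2))) with ha
  have ha0 : 0 < a := by positivity
  have hd : deriv (bh C k R) (ρ ^ 2) = a := by rw [bh_deriv]
  left
  constructor
  · rw [sGrad_rad g ((bh_contDiff C k R).differentiable (by norm_num)), ← hρ, hd]
    exact smul_ne_zero (by positivity) (sub_ne_zero.2 hne)
  · rw [opF_rad γ p g (bh_contDiff C k R) _ z hne (by rw [← hρ, hd]; exact ha0.ne'), ← hρ, hd, bh_deriv2,
      ← ha, tD_rad, norm_smul, ← hρ, Real.norm_eq_abs, abs_of_pos (by positivity : 0 < 2 * a)]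
    have e1 : 2 * a * (n + p - 2) + 4 * (p - 1) * (-k * a) * ρ ^ 2 ≤ - a := by
      have h1 : 4 * (p - 1) * k * R ^ 2 ≤ 4 * (p - 1) * k * ρ ^ 2 := by
        have : 0 < p - 1 := by linarith
        gcongr
      have h2 : a * (2 * (n + p - 2) + 1 - 4 * (p - 1) * k * ρ ^ 2) ≤ 0 :=
        mul_nonpos_of_nonneg_of_nonpos ha0.le (by linarith)
      linarith
    have e2 : (6 * a) ^ γ ≤ (2 * a * ρ) ^ γ := by
      refine Real.rpow_le_rpow_of_nonpos (by positivity) ?_ hγ.2.le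
      have : ρ ≤ 3 := by linarith
      nlinarith
    have e3 : (6 * a) ^ γ * a = 6 ^ γ * a ^ (1 + γ) := by
      rw [Real.mul_rpow (by norm_num) ha0.le, add_comm, Real.rpow_add ha0, Real.rpow_one]
      ring
    have e4 : (C * (k * Real.exp (-(k * (9 * R ^ 2))))) ^ (1 + γ) ≤ a ^ (1 + γ) := by
      refine Real.rpow_le_rpow (by positivity) ?_ h1γ.le
      rw [ha]
      have : ρ ^ 2 ≤ 9 * R ^ 2 := by nlinarith
      gcongr
    have e5 := hC0' C hC
    have e6 : (6 : ℝ) ^ γ * (C * (k * Real.exp (-(k * (9 * R ^ 2))))) ^ (1 + γ) ≤ 6 ^ γ * a ^ (1 + γ) := by gcongr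
    have e7 : (2 * a * ρ) ^ γ * (2 * a * (n + p - 2) + 4 * (p - 1) * (-k * a) * ρ ^ 2) ≤ (2 * a * ρ) ^ γ * (-a) := by
      gcongr
    have e8 : (6 * a) ^ γ * a ≤ (2 * a * ρ) ^ γ * a := by gcongr
    linarith

lemma Dat.barrier (H : Dat n γ p m R ε u) {δ s : ℝ} (hδ : 0 < δ) (hs : 0 < s) :
    ∃ β : En n × ℝ → En n × ℝ → ℝ, Continuous (fun q : (En n × ℝ) × (En n × ℝ) => β q.1 q.2) ∧
      (∀ z0, ContDiff ℝ 2 (β z0)) ∧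
      (∀ z0 ∈ Ks n R s, ∀ z ∈ pCyl n R, Bad γ p m 0 (β z0) z) ∧
      (∀ z0 ∈ Ks n R s, ∀ z : En n × ℝ, ‖z.1‖ ≤ R → 0 ≤ β z0 z) ∧
      (∀ z0 ∈ Ks n R s, ∀ z ∈ Dl n R, |u z - u z0| ≤ δ + β z0 z) ∧
      (∀ z0 ∈ Ks n R s, ∀ z : En n × ℝ, ‖z.1‖ ≤ R → -s ≤ z.2 → 3 ≤ β z0 z) ∧
      (∃ d > 0, ∀ z0 ∈ Ks n R (2 * s), ∀ z ∈ Dl n R, dist z z0 < d → β z0 z < δ) := by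
  have hR := H.hR
  have hR1 := H.hR1
  -- modulus of continuity
  have huc : UniformContinuousOn u (Kc n R s) :=
    (Kc_compact n R s).uniformContinuousOn_of_continuous (H.hu.mono fun z hz => H.Kc_sub hs hz)
  obtain ⟨ρ, hρ, hmod⟩ := Metric.uniformContinuousOn_iff.1 huc δ hδ
  set K := 1 / ρ ^ 2 with hK
  have hK0 : 0 < K := by positivity
  obtain ⟨k, hk, C0, hC0, hbad⟩ := bad_barrier (n := n) (m := m) H.hγ H.hp hR hR1 (2 * K)
  set C := max C0 (1 / (Real.exp (-(k * R ^ 2)) - Real.exp (-(k * (R ^ 2 + ρ ^ 2))))) with hC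
  have hC0' : 0 < C := hC0.trans_le (le_max_left _ _)
  have hmono : ∀ σ1 σ2 : ℝ, σ1 ≤ σ2 → bh C k R σ1 ≤ bh C k R σ2 := by
    intro σ1 σ2 h
    unfold bh
    gcongr
  have hbhR : bh C k R (R ^ 2) = 0 := by simp [bh]
  have hbhρ : 1 ≤ bh C k R (R ^ 2 + ρ ^ 2) := by
    have h1 : 0 < Real.exp (-(k * R ^ 2)) - Real.exp (-(k * (R ^ 2 + ρ ^ 2))) := by
      rw [sub_pos, Real.exp_lt_exp]
      have : 0 < k * ρ ^ 2 := by positivity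
      nlinarith
    have h2 : 1 / (Real.exp (-(k * R ^ 2)) - Real.exp (-(k * (R ^ 2 + ρ ^ 2)))) ≤ C := le_max_right _ _
    rw [div_le_iff₀ h1] at h2
    exact h2
  set g : ℝ → ℝ → ℝ := fun t0 t => K * (t - t0) ^ 2 + stepF 3 (-(2 * s)) s t with hg
  have hst := stepF_contDiff 3 (-(2 * s)) s
  have hgC : ∀ t0, ContDiff ℝ 2 (g t0) := by
    intro t0
    simp only [hg]; fun_prop
  set β : En n × ℝ → En n × ℝ → ℝ := fun z0 => rad (g z0.2) (bh C k R) ((2 : ℝ) • z0.1) with hβ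
  have hβc : Continuous (fun q : (En n × ℝ) × (En n × ℝ) => β q.1 q.2) := by
    have h1 := (bh_contDiff C k R).continuous
    have h2 := hst.continuous
    simp only [hβ, rad, hg]
    fun_prop
  have hxpart : ∀ z0 ∈ Ks n R s, ∀ z : En n × ℝ, ‖z.1‖ ≤ R → 0 ≤ bh C k R (‖z.1 - (2 : ℝ) • z0.1‖ ^ 2) := by
    intro z0 hz0 z hz
    obtain ⟨b1, b2, b3⟩ := bgeom hz0.1 hz
    rw [← hbhR]
    refine hmono _ _ ?_
    gcongr
  have hsn : ∀ t, 0 ≤ stepF 3 (-(2 * s)) s t := stepF_nonneg _ _ (by norm_num)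
  have hnn : ∀ z0 ∈ Ks n R s, ∀ z : En n × ℝ, ‖z.1‖ ≤ R → 0 ≤ β z0 z := by
    intro z0 hz0 z hz
    have h1 := hxpart z0 hz0 z hz
    have h2 := hsn z.2
    simp only [hβ, rad, hg]
    positivity
  have h3 : ∀ z0 ∈ Ks n R s, ∀ z : En n × ℝ, ‖z.1‖ ≤ R → -s ≤ z.2 → 3 ≤ β z0 z := by
    intro z0 hz0 z hz hzs
    have h1 := hxpart z0 hz0 z hz
    have h2 : 0 ≤ K * (z.2 - z0.2) ^ 2 := by positivity
    simp only [hβ, rad, hg]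
    rw [stepF_one hs (by linarith)]
    linarith
  refine ⟨β, hβc, fun z0 => rad_contDiff (hgC _) (bh_contDiff _ _ _) _, ?_, hnn, ?_, h3, ?_⟩
  · intro z0 hz0 z hz
    refine hbad C (le_max_left _ _) _ _ hz0.1 z hz ?_
    have d1 : HasDerivAt (fun t : ℝ => K * (t - z0.2) ^ 2) _ z.2 :=
      (((hasDerivAt_id z.2).sub_const z0.2).pow 2).const_mul K
    have d2 := (hst.differentiable (by norm_num) z.2).hasDerivAt
    have d3 : deriv (g z0.2) z.2 = _ := (d1.add d2).deriv
    rw [d3]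
    have d4 := stepF_deriv (-(2 * s)) (show (0:ℝ) ≤ 3 by norm_num) hs z.2
    simp only [id_eq]
    have e1 : z0.2 - z.2 ≤ 1 := by
      have := hz0.2.2
      have := hz.2.1
      nlinarith
    have e2 : K * (z0.2 - z.2) ≤ K * 1 := by gcongr
    norm_num
    linarith
  · intro z0 hz0 z hz
    have hz1 := H.Dl_sub hz
    have hz01 := H.Kc_sub hs (Ks_sub_Kc hz0)
    have hosc : |u z - u z0| ≤ 1 := abs_le.2 ⟨by linarith [H.hosc z0 hz01 z hz1], H.hosc z hz1 z0 hz01⟩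
    have hb0 := hnn z0 hz0 z hz.1
    rcases le_total (-s) z.2 with h | h
    · linarith [h3 z0 hz0 z hz.1 h]
    · have hzK : z ∈ Kc n R s := ⟨hz.1, hz.2.1.le, h⟩
      by_cases hd : dist z z0 < ρ
      · have := hmod z hzK z0 (Ks_sub_Kc hz0) hd
        rw [Real.dist_eq] at this
        linarith
      · push Not at hd
        rw [Prod.dist_eq, le_max_iff, dist_eq_norm, Real.dist_eq] at hd
        have e1 := hxpart z0 hz0 z hz.1
        have e2 := hsn z.2
        have e3 : 0 ≤ K * (z.2 - z0.2) ^ 2 := by positivity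
        suffices h : 1 ≤ β z0 z by linarith
        simp only [hβ, rad, hg]
        rcases hd with hd | hd
        · obtain ⟨b1, b2, b3⟩ := bgeom hz0.1 hz.1
          have : bh C k R (R ^ 2 + ρ ^ 2) ≤ bh C k R (‖z.1 - (2 : ℝ) • z0.1‖ ^ 2) := by
            refine hmono _ _ (le_trans ?_ b3)
            gcongr
          linarith
        · have : ρ ^ 2 ≤ (z.2 - z0.2) ^ 2 := by
            rw [← sq_abs (z.2 - z0.2)]; gcongr
          have h5 : 1 ≤ K * (z.2 - z0.2) ^ 2 := by
            rw [hK, div_mul_eq_mul_div, one_mul, one_le_div (by positivity)]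
            exact this
          linarith
  · have hcomp : IsCompact (Ks n R (2 * s) ×ˢ Kc n R 0) := (Ks_compact _ _ _).prod (Kc_compact _ _ _)
    obtain ⟨d, hd, hun⟩ := Metric.uniformContinuousOn_iff.1
      (hcomp.uniformContinuousOn_of_continuous hβc.continuousOn) δ hδ
    refine ⟨d, hd, ?_⟩
    intro z0 hz0 z hz hdist
    have hz0K : z0 ∈ Kc n R 0 := ⟨hz0.1.le, hz0.2.1, by linarith [hz0.2.2]⟩
    have hzK : z ∈ Kc n R 0 := ⟨hz.1, hz.2.1.le, by linarith [hz.2.2]⟩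
    have h := hun (z0, z) ⟨hz0, hzK⟩ (z0, z0) ⟨hz0, hz0K⟩ (by
      rw [Prod.dist_eq]; simpa using hdist)
    have hzero : β z0 z0 = 0 := by
      have e1 : z0.1 - (2 : ℝ) • z0.1 = - z0.1 := by rw [two_smul]; abel
      simp only [hβ, rad, hg]
      rw [e1, norm_neg, hz0.1, hbhR, stepF_zero hs hz0.2.2]
      simp
    simp only [hzero, Real.dist_eq, sub_zero] at h
    exact (le_abs_self _).trans_lt h

end barrier


section perron
variable {n : ℕ} {γ p : ℝ} {m : ℕ} {R ε : ℝ} {u : En n × ℝ → ℝ}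

/-- Perron class -/
def PS (n : ℕ) (γ p : ℝ) (m : ℕ) (R ε : ℝ) (u : En n × ℝ → ℝ) : Set (En n × ℝ → ℝ) :=
  {w | ContinuousOn w (Dl n R) ∧ (∀ z ∈ pCyl n R, SubAt γ p m 0 w z) ∧
    (∀ z ∈ Dl n R, w z ≤ u z + ε * (z.2 + R ^ 2)) ∧ (∀ z ∈ Dl n R, ‖z.1‖ = R → w z ≤ u z)}

lemma Dl_time {z : En n × ℝ} (hz : z ∈ Dl n R) : 0 < z.2 + R ^ 2 := by
  have := hz.2.1
  linarith

lemma Dat.time_le (H : Dat n γ p m R ε u) {z : En n × ℝ} (hz : z ∈ Dl n R) : ε * (z.2 + R ^ 2) ≤ 1 := by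
  have h1 := Dl_time hz
  have h2 := hz.2.2
  have h3 : R ^ 2 ≤ 1 := by have := H.hR; have := H.hR1; nlinarith
  have h4 : z.2 + R ^ 2 ≤ 1 := by linarith
  have := H.hε
  have := H.hε1
  nlinarith

lemma Dat.uc (H : Dat n γ p m R ε u) : ContinuousOn u (Dl n R) := H.hu.mono fun _ hz => H.Dl_sub hz

lemma Dat.minus_mem (H : Dat n γ p m R ε u) : (fun z => u z - ε * (z.2 + R ^ 2)) ∈ PS n γ p m R ε u := by
  refine ⟨H.uc.sub (by fun_prop), ?_, ?_, ?_⟩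
  · intro z hz
    have hk : ContDiff ℝ 2 (fun t : ℝ => - (ε * (t + R ^ 2))) := by fun_prop
    have h1 := (H.hsub z (H.Dl_sub (D_sub_Dl hz))).add_time hk
    have hd : deriv (fun t : ℝ => - (ε * (t + R ^ 2))) z.2 = - ε := by
      have : HasDerivAt (fun t : ℝ => - (ε * (t + R ^ 2))) (-(ε * 1)) z.2 :=
        (((hasDerivAt_id z.2).add_const (R ^ 2)).const_mul ε).neg
      rw [this.deriv, mul_one]
    rw [hd, add_neg_cancel] at h1
    simpa only [← sub_eq_add_neg] using h1
  · intro z hz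
    have := mul_pos H.hε (Dl_time hz)
    simp only
    linarith
  · intro z hz _
    have := mul_pos H.hε (Dl_time hz)
    simp only
    linarith

/-- comparison with the barrier from above -/
lemma Dat.upper (H : Dat n γ p m R ε u) {δ s : ℝ} (hδ : 0 < δ)
    {z0 : En n × ℝ} {b : En n × ℝ → ℝ} (hbC : ContDiff ℝ 2 b)
    (hbad : ∀ z ∈ pCyl n R, Bad γ p m 0 b z) (hs : 0 < s) (hz0 : z0 ∈ Ks n R s)
    (hnn : ∀ z : En n × ℝ, ‖z.1‖ ≤ R → 0 ≤ b z)
    (hu : ∀ z ∈ Dl n R, |u z - u z0| ≤ δ + b z)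
    (h3 : ∀ z : En n × ℝ, ‖z.1‖ ≤ R → -s ≤ z.2 → 3 ≤ b z)
    {w : En n × ℝ → ℝ} (hw : w ∈ PS n γ p m R ε u) {z : En n × ℝ} (hz : z ∈ Dl n R) :
    w z ≤ u z0 + 2 * δ + b z := by
  obtain ⟨wc, wsub, wle, wlat⟩ := hw
  by_contra hcon
  push Not at hcon
  set d := δ / ε with hd
  have hdp : 0 < d := div_pos hδ H.hε
  have hεd : ε * d = δ := by rw [hd]; have := H.hε.ne'; field_simp
  -- a violation forces interior position
  have hinside : ∀ y ∈ Dl n R, u z0 + 2 * δ + b y < w y → ‖y.1‖ < R ∧ -R ^ 2 + d < y.2 ∧ y.2 < -s := by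
    intro y hy hyw
    have h1 := abs_le.1 (hu y hy)
    refine ⟨?_, ?_, ?_⟩
    · refine lt_of_le_of_ne hy.1 fun he => ?_
      have := wlat y hy he
      linarith [h1.2]
    · by_contra hc
      push Not at hc
      have h2 := wle y hy
      have h4 : ε * (y.2 + R ^ 2) ≤ ε * d := by
        have := H.hε
        gcongr
        linarith
      linarith [h1.2]
    · by_contra hc
      push Not at hc
      have h2 := wle y hy
      have h4 := H.time_le hy
      have h5 := h3 y hy.1 hc
      have h6 := H.hosc y (H.Dl_sub hy) z0 (H.Kc_sub hs (Ks_sub_Kc hz0))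
      linarith
  obtain ⟨i1, i2, i3⟩ := hinside z hz hcon
  set K : Set (En n × ℝ) := Metric.closedBall (0 : En n) R ×ˢ Set.Icc (-R ^ 2 + d) (-s) with hK
  have hKc : IsCompact K := (isCompact_closedBall _ _).prod isCompact_Icc
  have hKD : ∀ y ∈ K, y ∈ Dl n R := by
    rintro y ⟨h1, h2⟩
    exact ⟨by simpa using h1, by linarith [h2.1], by linarith [h2.2]⟩
  have hzK : z ∈ K := ⟨by simpa using hz.1, i2.le, i3.le⟩
  obtain ⟨z1, hz1, hmax⟩ := hKc.exists_isMaxOn ⟨_, hzK⟩ ((wc.mono hKD).sub hbC.continuous.continuousOn)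
  have h1 : w z - b z ≤ w z1 - b z1 := hmax hzK
  obtain ⟨j1, j2, j3⟩ := hinside z1 (hKD z1 hz1) (by linarith)
  have hz1D : z1 ∈ pCyl n R := ⟨j1, (hKD z1 hz1).2⟩
  refine Bad.not_touch (by have := H.hm; omega) hbC (hbad z1 hz1D) (wsub z1 hz1D) ?_
  have hnhds : Metric.ball (0 : En n) R ×ˢ Set.Ioo (-R ^ 2 + d) (-s) ∈ 𝓝 z1 :=
    (Metric.isOpen_ball.prod isOpen_Ioo).mem_nhds ⟨by simpa using j1, j2, j3⟩
  filter_upwards [hnhds] with y hy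
  exact hmax (show y ∈ K from ⟨Metric.ball_subset_closedBall hy.1, Ioo_subset_Icc_self hy.2⟩)

lemma Dat.Ks_nonempty (H : Dat n γ p m R ε u) {s : ℝ} (hs : s ≤ R ^ 2) : (Ks n R s).Nonempty := by
  have hn := H.hn
  haveI : Nonempty (Fin n) := ⟨⟨0, by omega⟩⟩
  obtain ⟨x, hx⟩ := NormedSpace.sphere_nonempty (E := En n) (x := 0) (r := R) |>.2 H.hR.le
  exact ⟨(x, -s), by simpa using hx, by simp; linarith⟩

lemma max_mem (H : Dat n γ p m R ε u) {w w' : En n × ℝ → ℝ} (h : w ∈ PS n γ p m R ε u)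
    (h' : w' ∈ PS n γ p m R ε u) : (fun z => max (w z) (w' z)) ∈ PS n γ p m R ε u := by
  refine ⟨fun z hz => (h.1 z hz).max (h'.1 z hz), ?_, fun z hz => max_le (h.2.2.1 z hz) (h'.2.2.1 z hz),
    fun z hz hl => max_le (h.2.2.2 z hz hl) (h'.2.2.2 z hz hl)⟩
  intro z hz
  rcases le_total (w z) (w' z) with hle | hle
  · exact (h'.2.1 z hz).of_le (Eventually.of_forall fun y => le_max_right _ _) (by simp [hle])
  · exact (h.2.1 z hz).of_le (Eventually.of_forall fun y => le_max_left _ _) (by simp [hle])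

/-- barrier from below -/
lemma Dat.lower (H : Dat n γ p m R ε u) {δ s : ℝ} (hδ : 0 < δ) (hs : 0 < s) (hsR : s ≤ R ^ 2)
    {β : En n × ℝ → En n × ℝ → ℝ} (hβ : Continuous (fun q : (En n × ℝ) × (En n × ℝ) => β q.1 q.2))
    (hbC : ∀ z0, ContDiff ℝ 2 (β z0))
    (hbad : ∀ z0 ∈ Ks n R s, ∀ z ∈ pCyl n R, Bad γ p m 0 (β z0) z)
    (hu : ∀ z0 ∈ Ks n R s, ∀ z ∈ Dl n R, |u z - u z0| ≤ δ + β z0 z) :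
    ∃ w ∈ PS n γ p m R ε u, (∀ z ∈ Dl n R, u z - ε * (z.2 + R ^ 2) ≤ w z) ∧
      ∀ z0 ∈ Ks n R s, ∀ z ∈ Dl n R, u z0 - δ - β z0 z ≤ w z := by
  haveI : CompactSpace (Ks n R s) := isCompact_iff_compactSpace.1 (Ks_compact n R s)
  haveI : Nonempty (Ks n R s) := (H.Ks_nonempty hsR).to_subtype
  set F : En n × ℝ → Ks n R s → ℝ := fun z z0 => u z0 - δ - β z0 z with hF
  have huK : Continuous (fun z0 : Ks n R s => u z0) :=
    continuousOn_iff_continuous_domRestrict.1 (H.hu.mono fun z hz => H.Kc_sub hs (Ks_sub_Kc hz))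
  have hFc : Continuous (Function.uncurry F) := by
    have h1 : Continuous (fun q : (En n × ℝ) × Ks n R s => β q.2 q.1) :=
      hβ.comp (((continuous_subtype_val).comp continuous_snd).prodMk continuous_fst)
    exact ((huK.comp continuous_snd).sub continuous_const).sub h1
  set Φ : En n × ℝ → ℝ := fun z => sSup (F z '' univ) with hΦ
  have hΦc : Continuous Φ := isCompact_univ.continuous_sSup hFc
  have hFz : ∀ z, Continuous (F z) := fun z => hFc.comp (continuous_const.prodMk continuous_id)
  have hatt : ∀ z, ∃ z0, Φ z = F z z0 := by
    intro z
    obtain ⟨z0, _, h, _⟩ := isCompact_univ.exists_sSup_image_eq_and_ge univ_nonempty (hFz z).continuousOn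
    exact ⟨z0, h⟩
  have hge : ∀ z z0, F z z0 ≤ Φ z := fun z z0 =>
    le_csSup (isCompact_univ.image (hFz z)).bddAbove ⟨z0, mem_univ _, rfl⟩
  have hΦu : ∀ z ∈ Dl n R, Φ z ≤ u z := by
    intro z hz
    obtain ⟨z0, h⟩ := hatt z
    rw [h]
    have := abs_le.1 (hu z0 z0.2 z hz)
    simp only [hF]
    linarith [this.1]
  have hΦS : Φ ∈ PS n γ p m R ε u := by
    refine ⟨hΦc.continuousOn, ?_, ?_, fun z hz _ => hΦu z hz⟩
    · intro z hz
      obtain ⟨z0, h⟩ := hatt z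
      have h1 := (hbad z0 z0.2 z hz).neg_sub H.hp H.hm (hbC z0)
      have h2 := h1.add_time (k := fun _ => u z0 - δ) contDiff_const
      simp only [deriv_const, neg_zero, add_zero] at h2
      refine h2.of_le (Eventually.of_forall fun y => ?_) ?_
      · have := hge y z0
        simp only [hF] at this
        linarith
      · rw [h]; simp only [hF]; ring
    · intro z hz
      have := mul_pos H.hε (Dl_time hz)
      linarith [hΦu z hz]
  refine ⟨_, max_mem H H.minus_mem hΦS, fun z _ => le_max_left _ _, fun z0 hz0 z _ => ?_⟩
  exact (hge z ⟨z0, hz0⟩).trans (le_max_right _ _)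

/-- Perron solution -/
def PV (n : ℕ) (γ p : ℝ) (m : ℕ) (R ε : ℝ) (u : En n × ℝ → ℝ) (z : En n × ℝ) : ℝ :=
  sSup ((fun w : En n × ℝ → ℝ => w z) '' PS n γ p m R ε u)

lemma Dat.le_PV (_H : Dat n γ p m R ε u) {w : En n × ℝ → ℝ} (hw : w ∈ PS n γ p m R ε u) {z : En n × ℝ}
    (hz : z ∈ Dl n R) : w z ≤ PV n γ p m R ε u z := by
  refine le_csSup ⟨u z + ε * (z.2 + R ^ 2), ?_⟩ ⟨w, hw, rfl⟩
  rintro _ ⟨w', hw', rfl⟩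
  exact hw'.2.2.1 z hz

lemma Dat.PV_le (H : Dat n γ p m R ε u) {z : En n × ℝ} {a : ℝ}
    (h : ∀ w ∈ PS n γ p m R ε u, w z ≤ a) : PV n γ p m R ε u z ≤ a := by
  refine csSup_le ⟨_, _, H.minus_mem, rfl⟩ ?_
  rintro _ ⟨w', hw', rfl⟩
  exact h w' hw'

lemma Dat.PV_approx (H : Dat n γ p m R ε u) {z : En n × ℝ} {η : ℝ} (hη : 0 < η) :
    ∃ w ∈ PS n γ p m R ε u, PV n γ p m R ε u z - η < w z := by
  by_contra hc
  push Not at hc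
  have := H.PV_le hc
  linarith

lemma Dat.PV_bounds (H : Dat n γ p m R ε u) {z : En n × ℝ} (hz : z ∈ Dl n R) :
    u z - ε * (z.2 + R ^ 2) ≤ PV n γ p m R ε u z ∧ PV n γ p m R ε u z ≤ u z + ε * (z.2 + R ^ 2) :=
  ⟨H.le_PV H.minus_mem hz, H.PV_le fun w hw => hw.2.2.1 z hz⟩

/-- behaviour of the Perron solution at the lateral boundary -/
lemma Dat.PV_lat (H : Dat n γ p m R ε u) {z0 : En n × ℝ} (hz0 : z0 ∈ Dl n R) (hl : ‖z0.1‖ = R) :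
    ContinuousWithinAt (PV n γ p m R ε u) (Dl n R) z0 := by
  rw [Metric.continuousWithinAt_iff]
  intro e he
  set δ := e / 7 with hδ
  have hδ0 : 0 < δ := by positivity
  set s := - z0.2 / 2 with hs
  have hs0 : 0 < s := by have := hz0.2.2; rw [hs]; linarith
  have hsR : s ≤ R ^ 2 := by have := hz0.2.1; rw [hs]; nlinarith [H.hR]
  obtain ⟨β, b1, b2, b3, b4, b5, b6, d, hd, b7⟩ := H.barrier hδ0 hs0
  have hz0K : z0 ∈ Ks n R (2 * s) := ⟨hl, hz0.2.1.le, by rw [hs]; linarith⟩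
  have hz0K' : z0 ∈ Ks n R s := ⟨hl, hz0.2.1.le, by rw [hs]; linarith⟩
  obtain ⟨w1, hw1, hw1a, hw1b⟩ := H.lower hδ0 hs0 hsR b1 b2 b3 b5
  have key : ∀ z ∈ Dl n R, dist z z0 < d → |PV n γ p m R ε u z - u z0| ≤ 3 * δ := by
    intro z hz hdz
    have h1 := b7 z0 hz0K z hz hdz
    rw [abs_le]
    constructor
    · have h2 := hw1b z0 hz0K' z hz
      have h3 := H.le_PV hw1 hz
      linarith
    · have : PV n γ p m R ε u z ≤ u z0 + 3 * δ := by
        refine H.PV_le fun w hw => ?_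
        have := H.upper hδ0 (b2 z0) (b3 z0 hz0K') hs0 hz0K' (b4 z0 hz0K') (b5 z0 hz0K') (b6 z0 hz0K') hw hz
        linarith
      linarith
  refine ⟨d, hd, fun z hz hdz => ?_⟩
  have h1 := abs_le.1 (key z hz hdz)
  have h2 := abs_le.1 (key z0 hz0 (by simpa using hd))
  rw [Real.dist_eq]
  have : 6 * δ < e := by rw [hδ]; linarith
  rw [abs_lt]
  constructor <;> linarith [h1.1, h1.2, h2.1, h2.2]

end perron


section transl
variable {n : ℕ} {γ p : ℝ} {m : ℕ} {R ε : ℝ} {u : En n × ℝ → ℝ}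

lemma SubAt.shift_time {w : En n × ℝ → ℝ} {z h : En n × ℝ} {η : ℝ} {k : ℝ → ℝ} (hk : ContDiff ℝ 2 k)
    (hd : 0 ≤ deriv k z.2) (hw : SubAt γ p m 0 w (z + h)) :
    SubAt γ p m 0 (fun y => w (y + h) - η - k y.2) z := by
  have h1 : ContDiff ℝ 2 (fun t => -η - k t) := contDiff_const.sub hk
  have h2 := (hw.translate).add_time h1
  have h3 : deriv (fun t => -η - k t) z.2 = - deriv k z.2 := by
    have : HasDerivAt (fun t => -η - k t) (-deriv k z.2) z.2 :=
      ((hk.differentiable (by norm_num)) z.2).hasDerivAt.const_sub (-η)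
    exact this.deriv
  rw [h3] at h2
  have h4 := h2.mono_c (c' := 0) (by linarith)
  refine h4.of_le (Eventually.of_forall fun y => ?_) ?_
  · linarith
  · ring

open Classical in
/-- glueing lemma -/
lemma Dat.glue (H : Dat n γ p m R ε u) {w1 g : En n × ℝ → ℝ} (hw1 : w1 ∈ PS n γ p m R ε u)
    {E N : Set (En n × ℝ)} (hE : IsOpen E) (hN : IsOpen N) (hED : E ⊆ pCyl n R)
    (hA : ∀ z ∈ E, z ∈ N → g z ≤ w1 z) (hB : ∀ z ∈ Dl n R, z ∉ N → z ∈ E)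
    (hgc : ∀ z ∈ E, ContinuousAt g z) (hgs : ∀ z ∈ E, SubAt γ p m 0 g z)
    (hgu : ∀ z ∈ E, z ∉ N → g z ≤ u z + ε * (z.2 + R ^ 2)) :
    ∀ z ∈ E, g z ≤ PV n γ p m R ε u z := by
  set W : En n × ℝ → ℝ := fun z => if z ∈ E then max (g z) (w1 z) else w1 z with hW
  have hWE : ∀ z ∈ E, W z = max (g z) (w1 z) := fun z hz => by simp only [hW]; rw [if_pos hz]
  have hWN : ∀ z ∈ N, W z = w1 z := by
    intro z hz
    by_cases he : z ∈ E
    · rw [hWE z he, max_eq_right (hA z he hz)]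
    · simp only [hW]; rw [if_neg he]
  have hle : ∀ z, w1 z ≤ W z := by
    intro z
    by_cases he : z ∈ E
    · rw [hWE z he]; exact le_max_right _ _
    · simp only [hW]; rw [if_neg he]
  have hw1c : ∀ z ∈ pCyl n R, ContinuousAt w1 z := fun z hz =>
    (hw1.1 z (D_sub_Dl hz)).continuousAt
      (mem_of_superset ((pCyl_isOpen R).mem_nhds hz) fun y hy => D_sub_Dl hy)
  have hWS : W ∈ PS n γ p m R ε u := by
    refine ⟨?_, ?_, ?_, ?_⟩
    · intro z hz
      by_cases hzN : z ∈ N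
      · refine (hw1.1 z hz).congr_of_eventuallyEq ?_ (hWN z hzN)
        exact mem_nhdsWithin_of_mem_nhds (mem_of_superset (hN.mem_nhds hzN) fun y hy => hWN y hy)
      · have hzE := hB z hz hzN
        have h1 : ContinuousAt (fun y => max (g y) (w1 y)) z := (hgc z hzE).max (hw1c z (hED hzE))
        refine (h1.congr ?_).continuousWithinAt
        filter_upwards [hE.mem_nhds hzE] with y hy
        exact (hWE y hy).symm
    · intro z hz
      by_cases hzN : W z = w1 z
      · exact (hw1.2.1 z hz).of_le (Eventually.of_forall hle) hzN.symm
      · have hzE : z ∈ E := by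
          refine hB z (D_sub_Dl hz) fun h => hzN (hWN z h)
        have hmx := hWE z hzE
        have heq : W z = g z := by
          rcases max_choice (g z) (w1 z) with h | h
          · rw [hmx, h]
          · exact absurd (hmx.trans h) hzN
        refine (hgs z hzE).of_le ?_ heq.symm
        filter_upwards [hE.mem_nhds hzE] with y hy
        rw [hWE y hy]; exact le_max_left _ _
    · intro z hz
      by_cases hzN : z ∈ N
      · rw [hWN z hzN]; exact hw1.2.2.1 z hz
      · have hzE := hB z hz hzN
        rw [hWE z hzE]
        exact max_le (hgu z hzE hzN) (hw1.2.2.1 z hz)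
    · intro z hz hl
      by_cases hzN : z ∈ N
      · rw [hWN z hzN]; exact hw1.2.2.2 z hz hl
      · exact absurd (hED (hB z hz hzN)).1 (by rw [hl]; exact lt_irrefl _)
  intro z hz
  have h1 := H.le_PV hWS (D_sub_Dl (hED hz))
  rw [hWE z hz] at h1
  exact (le_max_left _ _).trans h1

lemma Dat.transl (H : Dat n γ p m R ε u) {η s : ℝ} (hη : 0 < η) (hs : 0 < s) (hsR : s ≤ R ^ 2) :
    ∃ ρ > 0, ∀ h : En n × ℝ, ‖h‖ < ρ → ∀ w ∈ PS n γ p m R ε u, ∀ z ∈ pCyl n R, z.2 ≤ -(8 * s) →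
      z + h ∈ pCyl n R → w (z + h) ≤ PV n γ p m R ε u z + η := by
  set δ := η / 8 with hδ
  have hη8 : η = 8 * δ := by rw [hδ]; ring
  have hδ0 : 0 < δ := by positivity
  obtain ⟨β, b1, b2, b3, b4, b5, b6, d, hd, b7⟩ := H.barrier hδ0 hs
  obtain ⟨w1, hw1, hw1a, hw1b⟩ := H.lower hδ0 hs hsR b1 b2 b3 b5
  have hR := H.hR
  have hε := H.hε
  set d1 := δ / ε with hd1
  have hd1p : 0 < d1 := div_pos hδ0 hε
  have hεd : ε * d1 = δ := by rw [hd1]; have := hε.ne'; field_simp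
  set d2 := min (d / 2) (R / 2) with hd2
  have hd2p : 0 < d2 := by rw [hd2]; positivity
  have d2a : d2 ≤ d / 2 := min_le_left _ _
  have d2b : d2 ≤ R / 2 := min_le_right _ _
  have huK : ContinuousOn u (Kc n R s) := H.hu.mono fun z hz => H.Kc_sub hs hz
  obtain ⟨ρu, hρu, hmod⟩ := Metric.uniformContinuousOn_iff.1
    ((Kc_compact n R s).uniformContinuousOn_of_continuous huK) δ hδ0
  set ρ := min ρu (min d1 (min d2 s)) with hρ
  have r1 : ρ ≤ ρu := min_le_left _ _
  have r2 : ρ ≤ d1 := (min_le_right _ _).trans (min_le_left _ _)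
  have r3 : ρ ≤ d2 := (min_le_right _ _).trans ((min_le_right _ _).trans (min_le_left _ _))
  have r4 : ρ ≤ s := (min_le_right _ _).trans ((min_le_right _ _).trans (min_le_right _ _))
  refine ⟨ρ, by rw [hρ]; positivity, ?_⟩
  intro h hh w hw z hz hzs hzh
  have hh1 : ‖h.1‖ < ρ := (norm_fst_le h).trans_lt hh
  have hh2 : |h.2| < ρ := (norm_snd_le h).trans_lt hh
  have hh3 := abs_lt.1 hh2
  set E : Set (En n × ℝ) := {y | y ∈ pCyl n R ∧ y + h ∈ pCyl n R} with hEdef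
  set N : Set (En n × ℝ) := {y | R - d2 < ‖y.1‖ ∨ y.2 + R ^ 2 < d1 ∨ -(4 * s) < y.2} with hNdef
  set g : En n × ℝ → ℝ := fun y => w (y + h) - η - stepF 3 (-(8 * s)) (4 * s) y.2 with hg
  have hE : IsOpen E := (pCyl_isOpen R).inter ((pCyl_isOpen R).preimage (by fun_prop))
  have hN : IsOpen N := by
    have o1 : IsOpen {y : En n × ℝ | R - d2 < ‖y.1‖} := isOpen_lt (by fun_prop) (by fun_prop)
    have o2 : IsOpen {y : En n × ℝ | y.2 + R ^ 2 < d1} := isOpen_lt (by fun_prop) (by fun_prop)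
    have o3 : IsOpen {y : En n × ℝ | -(4 * s) < y.2} := isOpen_lt (by fun_prop) (by fun_prop)
    exact o1.union (o2.union o3)
  have hst : ∀ t, 0 ≤ stepF 3 (-(8 * s)) (4 * s) t := fun t => stepF_nonneg _ _ (by norm_num) t
  have hcl : ∀ y ∈ E, y.2 ≤ -(4 * s) → |u (y + h) - u y| < δ := by
    intro y hy hys
    have k1 : y + h ∈ Kc n R s := ⟨hy.2.1.le, hy.2.2.1.le, by simp only [Prod.snd_add]; linarith⟩
    have k2 : y ∈ Kc n R s := ⟨hy.1.1.le, hy.1.2.1.le, by linarith⟩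
    have := hmod (y + h) k1 y k2 (by rw [dist_eq_norm, add_sub_cancel_left]; linarith)
    rwa [Real.dist_eq] at this
  have hmain := H.glue hw1 (g := g) hE hN (fun y hy => hy.1) ?_ ?_ ?_ ?_ ?_ z ⟨hz, hzh⟩
  · simp only [hg] at hmain
    rw [stepF_zero (by positivity) hzs] at hmain
    linarith
  · intro y hy hyN
    simp only [hg]
    have hst1 := hst y.2
    have hyDl := D_sub_Dl hy.1
    have hyhDl := D_sub_Dl hy.2
    rcases lt_or_ge (-(4 * s)) y.2 with ht | ht
    · rw [stepF_one (by positivity) (by linarith)]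
      have k1 := hw.2.2.1 _ hyhDl
      have k2 := H.time_le hyhDl
      have k3 := H.hosc _ (H.Dl_sub hyhDl) _ (H.Dl_sub hyDl)
      have k4 := hw1a y hyDl
      have k5 := H.time_le hyDl
      linarith
    · have hc := abs_lt.1 (hcl y hy ht)
      rcases hyN with hN1 | hN1 | hN1
      · have hx : 0 < ‖y.1‖ := by linarith
        set z0 : En n × ℝ := ((R / ‖y.1‖) • y.1, y.2) with hz0
        have hn0 : ‖z0.1‖ = R := by
          rw [hz0]; simp only [norm_smul, norm_div, Real.norm_eq_abs, abs_of_pos hR, abs_of_pos hx]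
          field_simp
        have hdist : dist y z0 < d / 2 := by
          have e1 : y - z0 = ((1 - R / ‖y.1‖) • y.1, 0) := by
            rw [hz0]; ext1
            · simp [sub_smul]
            · simp
          rw [dist_eq_norm, e1, Prod.norm_def]
          simp only [norm_smul, Real.norm_eq_abs, norm_zero]
          rw [max_eq_left (by positivity)]
          have e2 : |1 - R / ‖y.1‖| * ‖y.1‖ = R - ‖y.1‖ := by
            have : 1 ≤ R / ‖y.1‖ := by rw [one_le_div hx]; exact hyDl.1
            rw [abs_of_nonpos (by linarith)]
            field_simp
            ring
          rw [e2]; linarith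
        have hk2 : z0 ∈ Ks n R (2 * s) := ⟨hn0, hyDl.2.1.le, by simp only [hz0]; linarith⟩
        have hk1 : z0 ∈ Ks n R s := ⟨hn0, hyDl.2.1.le, by simp only [hz0]; linarith⟩
        have hdist2 : dist (y + h) z0 < d := by
          have : dist (y + h) y = ‖h‖ := by rw [dist_eq_norm, add_sub_cancel_left]
          have := dist_triangle (y + h) y z0
          linarith
        have a1 := b7 z0 hk2 y hyDl (by linarith)
        have a2 := b7 z0 hk2 _ hyhDl hdist2
        have a3 := H.upper hδ0 (b2 z0) (b3 z0 hk1) hs hk1 (b4 z0 hk1) (b5 z0 hk1) (b6 z0 hk1) hw hyhDl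
        have a4 := hw1b z0 hk1 y hyDl
        linarith
      · have k1 := hw.2.2.1 _ hyhDl
        have k4 := hw1a y hyDl
        have k5 : ε * (y.2 + R ^ 2) ≤ δ := by rw [← hεd]; gcongr
        have k6 : ε * ((y + h).2 + R ^ 2) ≤ 2 * δ := by
          have : (y + h).2 + R ^ 2 ≤ 2 * d1 := by simp only [Prod.snd_add]; linarith
          calc ε * ((y + h).2 + R ^ 2) ≤ ε * (2 * d1) := by gcongr
            _ = 2 * δ := by rw [← hεd]; ring
        linarith
      · linarith
  · intro y hy hyN
    have hyN' : ‖y.1‖ ≤ R - d2 ∧ d1 ≤ y.2 + R ^ 2 ∧ y.2 ≤ -(4 * s) := by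
      simpa only [hNdef, mem_ofPred_eq, not_or, not_lt] using hyN
    obtain ⟨q1, q2, q3⟩ := hyN'
    refine ⟨⟨by linarith, hy.2⟩, ?_, ?_, ?_⟩
    · have := norm_add_le y.1 h.1
      simp only [Prod.fst_add]
      linarith
    · simp only [Prod.snd_add]; linarith
    · simp only [Prod.snd_add]; linarith
  · intro y hy
    have c1 : ContinuousAt w (y + h) := (hw.1 _ (D_sub_Dl hy.2)).continuousAt
      (mem_of_superset ((pCyl_isOpen R).mem_nhds hy.2) fun y hy => D_sub_Dl hy)
    have c2 : ContinuousAt (fun y => w (y + h)) y :=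
      ContinuousAt.comp (f := fun y => y + h) c1 (by fun_prop)
    have c3 : Continuous (stepF 3 (-(8 * s)) (4 * s)) := (stepF_contDiff _ _ _).continuous
    exact (c2.sub continuousAt_const).sub (c3.comp continuous_snd).continuousAt
  · intro y hy
    exact (hw.2.1 _ hy.2).shift_time (stepF_contDiff _ _ _) (stepF_deriv _ (by norm_num) (by positivity) _)
  · intro y hy hyN
    have hyN' : ‖y.1‖ ≤ R - d2 ∧ d1 ≤ y.2 + R ^ 2 ∧ y.2 ≤ -(4 * s) := by
      simpa only [hNdef, mem_ofPred_eq, not_or, not_lt] using hyN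
    have hc := abs_lt.1 (hcl y hy hyN'.2.2)
    have k1 := hw.2.2.1 _ (D_sub_Dl hy.2)
    have k2 := hst y.2
    have k3 : ε * ((y + h).2 + R ^ 2) ≤ ε * (y.2 + R ^ 2) + δ := by
      have : (y + h).2 + R ^ 2 ≤ y.2 + R ^ 2 + d1 := by simp only [Prod.snd_add]; linarith
      calc ε * ((y + h).2 + R ^ 2) ≤ ε * (y.2 + R ^ 2 + d1) := by gcongr
        _ = _ := by rw [← hεd]; ring
    simp only [hg]
    linarith

lemma Dat.PV_cont (H : Dat n γ p m R ε u) : ContinuousOn (PV n γ p m R ε u) (Dl n R) := by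
  intro z hz
  rcases hz.1.lt_or_eq with hlt | heq
  · refine ContinuousAt.continuousWithinAt ?_
    have hzD : z ∈ pCyl n R := ⟨hlt, hz.2⟩
    rw [Metric.continuousAt_iff']
    intro e he
    set s := - z.2 / 16 with hs
    have hs0 : 0 < s := by have := hz.2.2; rw [hs]; linarith
    have hsR : s ≤ R ^ 2 := by have := hz.2.1; rw [hs]; nlinarith [H.hR]
    obtain ⟨ρ, hρ, ht⟩ := H.transl (half_pos he) hs0 hsR
    have n1 : {y : En n × ℝ | y.2 < -(8 * s)} ∈ 𝓝 z :=
      (isOpen_lt continuous_snd continuous_const).mem_nhds (by simp only [mem_ofPred_eq]; linarith)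
    filter_upwards [n1, (pCyl_isOpen R).mem_nhds hzD, Metric.ball_mem_nhds z hρ] with y hy1 hy2 hy3
    replace hy1 : y.2 < -(8 * s) := hy1
    rw [Metric.mem_ball, dist_eq_norm] at hy3
    have q1 : PV n γ p m R ε u y ≤ PV n γ p m R ε u z + e / 2 := H.PV_le fun w hw => by
      have := ht (y - z) hy3 w hw z hzD (by linarith) (by simpa using hy2)
      simpa using this
    have q2 : PV n γ p m R ε u z ≤ PV n γ p m R ε u y + e / 2 := H.PV_le fun w hw => by
      have := ht (z - y) (by rwa [norm_sub_rev]) w hw y hy2 hy1.le (by simpa using hzD)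
      simpa using this
    rw [Real.dist_eq, abs_lt]
    constructor <;> linarith
  · exact H.PV_lat hz heq

lemma Dat.PV_sub (H : Dat n γ p m R ε u) {z : En n × ℝ} (hz : z ∈ pCyl n R) :
    SubAt γ p m 0 (PV n γ p m R ε u) z :=
  visc_sup_sub H.hγ H.hm H.hm2 (pCyl_isOpen R) (PS n γ p m R ε u)
    (fun w hw => ⟨hw.1.mono fun z hz => D_sub_Dl hz, hw.2.1⟩)
    (fun z hz w hw => H.le_PV hw (D_sub_Dl hz))
    (fun z hz η hη => H.PV_approx hη) hz

lemma Dat.PV_mem (H : Dat n γ p m R ε u) : PV n γ p m R ε u ∈ PS n γ p m R ε u :=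
  ⟨H.PV_cont, fun z hz => H.PV_sub hz, fun z hz => (H.PV_bounds hz).2,
    fun z hz hl => H.PV_le fun w hw => hw.2.2.2 z hz hl⟩

lemma Dat.PV_super (H : Dat n γ p m R ε u) {z0 : En n × ℝ} (hz0 : z0 ∈ pCyl n R) :
    SubAt γ p m 0 (fun z => - PV n γ p m R ε u z) z0 := by
  by_contra hns
  set P := PV n γ p m R ε u with hP
  have hm1 : 1 ≤ m := by have := H.hm; omega
  obtain ⟨φ, r, κ, hφ, hr, hκ, hrU, hφ0, hball, hsph⟩ :=
    exists_strict H.hγ H.hm H.hm2 ((pCyl_isOpen R).mem_nhds hz0) hns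
  set B := Metric.closedBall z0 r with hB
  have hBc : IsCompact B := isCompact_closedBall _ _
  have hz0B : z0 ∈ B := Metric.mem_closedBall_self hr.le
  have hBu : ContinuousOn u B := H.uc.mono fun z hz => D_sub_Dl (hrU hz)
  obtain ⟨z1, hz1, hmin⟩ := hBc.exists_isMinOn ⟨z0, hz0B⟩
    (f := fun z => u z + ε * (z.2 + R ^ 2) + φ z)
    ((hBu.add (by fun_prop)).add hφ.continuous.continuousOn)
  have hmin' : ∀ z ∈ B, u z1 + ε * (z1.2 + R ^ 2) + φ z1 ≤ u z + ε * (z.2 + R ^ 2) + φ z :=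
    fun z hz => hmin hz
  have hPle : ∀ z ∈ B, P z ≤ u z + ε * (z.2 + R ^ 2) := fun z hz => (H.PV_bounds (D_sub_Dl (hrU hz))).2
  have hpos : 0 < u z1 + ε * (z1.2 + R ^ 2) + φ z1 := by
    by_contra hc
    push Not at hc
    have hz1i : z1 ∈ Metric.ball z0 r := by
      refine Metric.mem_ball.2 (lt_of_le_of_ne (Metric.mem_closedBall.1 hz1) fun he => ?_)
      have h1 := hsph z1 he
      have h2 := hPle z1 hz1
      linarith
    have hk : ContDiff ℝ 2 (fun t : ℝ => - (ε * (t + R ^ 2))) := by fun_prop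
    have h1 := (H.hsup z1 (H.Dl_sub (D_sub_Dl (hrU hz1)))).add_time hk
    have hd : deriv (fun t : ℝ => - (ε * (t + R ^ 2))) z1.2 = - ε := by
      have : HasDerivAt (fun t : ℝ => - (ε * (t + R ^ 2))) (-(ε * 1)) z1.2 :=
        (((hasDerivAt_id z1.2).add_const (R ^ 2)).const_mul ε).neg
      rw [this.deriv, mul_one]
    rw [hd, add_neg_cancel] at h1
    refine Bad.not_touch hm1 hφ (hball z1 hz1).2 h1 ?_
    filter_upwards [Metric.isOpen_ball.mem_nhds hz1i] with y hy
    have := hmin' y (Metric.ball_subset_closedBall hy)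
    linarith
  set μ := u z1 + ε * (z1.2 + R ^ 2) + φ z1 with hμ
  set κ' := min (κ / 2) μ with hκ'
  have k1 : κ' ≤ κ / 2 := min_le_left _ _
  have k2 : κ' ≤ μ := min_le_right _ _
  have k0 : 0 < κ' := by rw [hκ']; positivity
  have hsub : ∀ z ∈ Metric.ball z0 r, z ∈ B := fun z hz => Metric.ball_subset_closedBall hz
  -- open neighbourhood of the complement of the open ball
  obtain ⟨N, hN, hN1, hN2, hN3⟩ : ∃ N : Set (En n × ℝ), IsOpen N ∧
      (∀ z ∈ Metric.ball z0 r, z ∈ N → - φ z + κ' ≤ P z) ∧ (∀ z, z ∉ N → z ∈ Metric.ball z0 r) ∧ True := by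
    have hPB : ContinuousOn (fun z => P z + φ z) (Metric.closedBall z0 r) :=
      (H.PV_cont.mono fun z hz => D_sub_Dl (hrU hz)).add hφ.continuous.continuousOn
    have hcl : IsClosed (B ∩ (fun z => P z + φ z) ⁻¹' (Iic κ')) :=
      hPB.preimage_isClosed_of_isClosed Metric.isClosed_closedBall isClosed_Iic
    refine ⟨(B ∩ (fun z => P z + φ z) ⁻¹' (Iic κ'))ᶜ, hcl.isOpen_compl, ?_, ?_, trivial⟩
    · intro z hz hzN
      by_contra hc
      push Not at hc
      exact hzN ⟨hsub z hz, by simp only [mem_preimage, mem_Iic]; linarith⟩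
    · intro z hz
      rw [mem_compl_iff, not_not] at hz
      refine Metric.mem_ball.2 (lt_of_le_of_ne (Metric.mem_closedBall.1 hz.1) fun he => ?_)
      have h1 := hsph z he
      have h2 : P z + φ z ≤ κ' := hz.2
      linarith
  have hmain := H.glue H.PV_mem (g := fun z => - φ z + κ') Metric.isOpen_ball hN
    (fun z hz => hrU (hsub z hz)) hN1 (fun z _ h => hN2 z h)
    (fun z _ => by have := hφ.continuous; fun_prop) ?_ ?_ z0 (Metric.mem_ball_self hr)
  · rw [← hP] at hmain
    linarith
  · intro z hz
    have h1 := ((hball z (hsub z hz)).2.neg_sub H.hp H.hm hφ).add_time (k := fun _ => κ') contDiff_const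
    simpa only [deriv_const, neg_zero, add_zero] using h1
  · intro z hz _
    have := hmin' z (hsub z hz)
    linarith

end transl


section final
variable {n : ℕ} {γ p : ℝ} {m : ℕ} {R ε : ℝ} {u : En n × ℝ → ℝ}

/-- values outside of the time interval, unbounded above and below near its end points -/
def junk (R : ℝ) (t : ℝ) : ℝ :=
  open Classical in (if Irrational t then 1 else -1) * (|t|⁻¹ + |t + R ^ 2|⁻¹)

lemma inv_big {a B : ℝ} (h0 : 0 < a) (h : a < (|B| + 1)⁻¹) : B < a⁻¹ := by
  have h1 : 0 < |B| + 1 := by positivity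
  have h2 := (lt_inv_comm₀ h0 h1).1 h
  linarith [le_abs_self B]

lemma junk_irr {R t : ℝ} (h : Irrational t) : junk R t = |t|⁻¹ + |t + R ^ 2|⁻¹ := by
  simp [junk, h]

lemma junk_rat {R : ℝ} (q : ℚ) : - junk R q = |(q : ℝ)|⁻¹ + |q + R ^ 2|⁻¹ := by
  simp [junk]

lemma junk_zero (R B e : ℝ) (he : 0 < e) :
    (∃ t ∈ Ioo 0 e, B < junk R t) ∧ (∃ t ∈ Ioo 0 e, B < - junk R t) := by
  have hpos : 0 < min e (|B| + 1)⁻¹ := by positivity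
  have key : ∀ t : ℝ, 0 < t → t < min e (|B| + 1)⁻¹ → B < |t|⁻¹ + |t + R ^ 2|⁻¹ := by
    intro t h1 h2
    have := inv_big (B := B) h1 (h2.trans_le (min_le_right _ _))
    rw [abs_of_pos h1]
    have : 0 ≤ |t + R ^ 2|⁻¹ := by positivity
    linarith
  constructor
  · obtain ⟨t, hi, h1, h2⟩ := exists_irrational_btwn hpos
    exact ⟨t, ⟨h1, h2.trans_le (min_le_left _ _)⟩, by rw [junk_irr hi]; exact key t h1 h2⟩
  · obtain ⟨t, h1, h2⟩ := exists_rat_btwn hpos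
    exact ⟨t, ⟨h1, h2.trans_le (min_le_left _ _)⟩, by rw [junk_rat]; exact key t h1 h2⟩

lemma junk_bot (R B e : ℝ) (he : 0 < e) :
    (∃ t ∈ Ioo (-R ^ 2 - e) (-R ^ 2), B < junk R t) ∧
    (∃ t ∈ Ioo (-R ^ 2 - e) (-R ^ 2), B < - junk R t) := by
  have hpos : 0 < min e (|B| + 1)⁻¹ := by positivity
  have hlt : -R ^ 2 - min e (|B| + 1)⁻¹ < -R ^ 2 := by linarith
  have hm : min e (|B| + 1)⁻¹ ≤ e := min_le_left _ _
  have key : ∀ t : ℝ, -R ^ 2 - min e (|B| + 1)⁻¹ < t → t < -R ^ 2 → B < |t|⁻¹ + |t + R ^ 2|⁻¹ := by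
    intro t h1 h2
    have h3 := inv_big (B := B) (a := -(t + R ^ 2)) (by linarith)
      (lt_of_lt_of_le (by linarith) (min_le_right e (|B| + 1)⁻¹))
    rw [abs_of_neg (show t + R ^ 2 < 0 by linarith)]
    have : 0 ≤ |t|⁻¹ := by positivity
    linarith
  constructor
  · obtain ⟨t, hi, h1, h2⟩ := exists_irrational_btwn hlt
    exact ⟨t, ⟨by linarith, h2⟩, by rw [junk_irr hi]; exact key t h1 h2⟩
  · obtain ⟨t, h1, h2⟩ := exists_rat_btwn hlt
    exact ⟨t, ⟨by linarith, h2⟩, by rw [junk_rat]; exact key t h1 h2⟩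

open Classical in
lemma Dat.exists_sol (H : Dat n γ p m R ε u) : ∃ V : En n × ℝ → ℝ,
    IsViscSol γ p (fun _ => 0) V (pCyl n R) ∧
    ∀ z ∈ Dl n R, |u z - V z| ≤ ε * (z.2 + R ^ 2) := by
  set P := PV n γ p m R ε u with hP
  set V : En n × ℝ → ℝ := fun z => if z.2 ∈ Ioo (-R ^ 2) (0 : ℝ) then P z else junk R z.2 with hV
  have hVP : ∀ z : En n × ℝ, z.2 ∈ Ioo (-R ^ 2) (0 : ℝ) → V z = P z := fun z hz => by
    simp only [hV]; rw [if_pos hz]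
  have hVJ : ∀ z : En n × ℝ, z.2 ∉ Ioo (-R ^ 2) (0 : ℝ) → V z = junk R z.2 := fun z hz => by
    simp only [hV]; rw [if_neg hz]
  have hVD : ∀ z ∈ pCyl n R, V z = P z := fun z hz => hVP z hz.2
  have hVc : ContinuousOn V (pCyl n R) :=
    (H.PV_cont.mono fun z hz => D_sub_Dl hz).congr hVD
  set zc : En n × ℝ := (0, -(1 / 2)) with hzc
  have hzc1 : zc ∈ pCyl n 1 := ⟨by simp [hzc], by simp only [hzc]; norm_num, by simp only [hzc]; norm_num⟩
  have hbd : ∀ z ∈ pCyl n R, |V z| ≤ |u zc| + 2 := by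
    intro z hz
    rw [hVD z hz]
    have h0 := D_sub_Dl hz
    have h1 := H.PV_bounds h0
    have h2 := H.time_le h0
    have h3 := H.hosc z (H.Dl_sub h0) zc hzc1
    have h4 := H.hosc zc hzc1 z (H.Dl_sub h0)
    rw [← hP] at h1
    have h5 := abs_le.1 (le_refl |u zc|)
    rw [abs_le]
    constructor <;> linarith [h1.1, h1.2, h5.1, h5.2]
  have ev : ∀ z ∈ pCyl n R, ∀ᶠ y in 𝓝 z, V y = P y := fun z hz => by
    filter_upwards [(pCyl_isOpen R).mem_nhds hz] with y hy using hVD y hy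
  have out0 : ∀ t : ℝ, 0 < t → t ∉ Ioo (-R ^ 2) (0 : ℝ) := fun t ht h => by linarith [h.2]
  have outR : ∀ t : ℝ, t < -R ^ 2 → t ∉ Ioo (-R ^ 2) (0 : ℝ) := fun t ht h => by linarith [h.1]
  refine ⟨V, ⟨hVc, ?_, ?_⟩, ?_⟩
  · rw [super_neg]
    simp only [neg_zero]
    refine e2 H.hγ H.hm H.hm2 hVc.neg (M := |u zc| + 2) (fun z hz => by rw [abs_neg]; exact hbd z hz) ?_ ?_ ?_
    · intro z hz
      refine (H.PV_super hz).of_le ?_ (by rw [hVD z hz])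
      filter_upwards [ev z hz] with y hy
      rw [hy]
    · intro x B e he
      obtain ⟨t, ht, h⟩ := (junk_zero R B e he).2
      exact ⟨t, ht, by rw [hVJ _ (out0 t ht.1)]; exact h⟩
    · intro x B e he
      obtain ⟨t, ht, h⟩ := (junk_bot R B e he).2
      exact ⟨t, ht, by rw [hVJ _ (outR t ht.2)]; exact h⟩
  · refine e2 H.hγ H.hm H.hm2 hVc hbd ?_ ?_ ?_
    · intro z hz
      refine (H.PV_sub hz).of_le ?_ (by rw [hVD z hz])
      filter_upwards [ev z hz] with y hy
      rw [hy]
    · intro x B e he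
      obtain ⟨t, ht, h⟩ := (junk_zero R B e he).1
      exact ⟨t, ht, by rw [hVJ _ (out0 t ht.1)]; exact h⟩
    · intro x B e he
      obtain ⟨t, ht, h⟩ := (junk_bot R B e he).1
      exact ⟨t, ht, by rw [hVJ _ (outR t ht.2)]; exact h⟩
  · intro z hz
    rw [hVP z hz.2, abs_le]
    have h1 := H.PV_bounds hz
    rw [← hP] at h1
    constructor <;> linarith [h1.1, h1.2]

lemma exists_m (hγ : γ ∈ Set.Ioo (-1 : ℝ) 0) : ∃ m : ℕ, 2 ≤ m ∧ 1 ≤ ((m : ℝ) - 1) * (1 + γ) := by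
  have h : 0 < 1 + γ := by linarith [hγ.1]
  obtain ⟨k, hk⟩ := exists_nat_ge (1 / (1 + γ))
  refine ⟨k + 2, by omega, ?_⟩
  rw [div_le_iff₀ h] at hk
  push_cast
  nlinarith

end final



end helpers

/-- **Lemma 3.1 (approximation lemma).** For `-1 < γ < 0`, `1 < p < ∞` and every `τ > 0`
there is `ε₀ = ε₀(p,n,γ,τ) ∈ (0,1)` such that if `u` is a viscosity solution of
`∂ₜ u - |Du|^γ Δ_p^N u = f` in `Q₁` with `osc_{Q₁} u ≤ 1` and `‖f‖_{L^∞(Q₁)} ≤ ε₀`, then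
there is a viscosity solution `ũ` of the homogeneous equation in `Q_{11/16}` with
`‖u - ũ‖_{L^∞(Q_{5/8})} ≤ τ`. -/
theorem approximation_lemma
    (n : ℕ) (hn : 1 ≤ n) (γ p : ℝ) (hγ : γ ∈ Set.Ioo (-1 : ℝ) 0) (hp : 1 < p)
    (τ : ℝ) (hτ : 0 < τ) :
    ∃ ε₀ ∈ Set.Ioo (0 : ℝ) 1,
      ∀ (u f : En n × ℝ → ℝ),
        IsViscSol γ p f u (pCyl n 1) →
        (∀ z ∈ pCyl n 1, ∀ w ∈ pCyl n 1, u z - u w ≤ 1) →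
        (∀ z ∈ pCyl n 1, |f z| ≤ ε₀) →
        ∃ v : En n × ℝ → ℝ,
          IsViscSol γ p (fun _ => 0) v (pCyl n (11/16)) ∧
          ∀ z ∈ pCyl n (5/8), |u z - v z| ≤ τ := by
  have hε0 : 0 < min τ 1 / 2 := by positivity
  have hε1 : min τ 1 ≤ 1 := min_le_right _ _
  have hετ : min τ 1 ≤ τ := min_le_left _ _
  refine ⟨min τ 1 / 2, ⟨hε0, by linarith⟩, ?_⟩
  intro u f hu hosc hf
  obtain ⟨m, hm, hm2⟩ := exists_m hγ
  set zc : En n × ℝ := (0, -(1 / 2)) with hzc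
  have hzc1 : zc ∈ pCyl n 1 := ⟨by simp [hzc], by simp only [hzc]; norm_num, by simp only [hzc]; norm_num⟩
  have H : Dat n γ p m (11 / 16) (min τ 1 / 2) u :=
    { hn := hn, hγ := hγ, hp := hp, hm := hm, hm2 := hm2, hR := by norm_num, hR1 := by norm_num
      hε := hε0, hε1 := by linarith, hu := hu.1, hosc := hosc
      hsub := fun z hz => e1 hγ hm hm2 (pCyl_isOpen 1) (pCyl_bounded 1) hu.1 (M := u zc + 1)
        (fun y hy => by linarith [hosc y hy zc hzc1]) hu.2.2 (fun y hy => (abs_le.1 (hf y hy)).2) hz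
      hsup := fun z hz => e1 hγ hm hm2 (pCyl_isOpen 1) (pCyl_bounded 1)
        (show ContinuousOn (fun y => - u y) (pCyl n 1) from hu.1.neg) (M := - u zc + 1)
        (fun y hy => by linarith [hosc zc hzc1 y hy]) (super_neg.1 hu.2.1)
        (fun y hy => by linarith [(abs_le.1 (hf y hy)).1]) hz }
  obtain ⟨V, hV, hV2⟩ := H.exists_sol
  refine ⟨V, hV, fun z hz => ?_⟩
  have hzD : z ∈ Dl n (11 / 16) := by
    obtain ⟨h1, h2, h3⟩ := hz
    exact ⟨by linarith, by norm_num at h2 ⊢; linarith, h3⟩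
  refine (hV2 z hzD).trans ?_
  have h1 := hzD.2.2
  have h2 := Dl_time hzD
  have h3 : z.2 + (11 / 16) ^ 2 ≤ 1 := by norm_num; linarith
  calc min τ 1 / 2 * (z.2 + (11 / 16) ^ 2) ≤ min τ 1 / 2 * 1 := by gcongr
    _ ≤ τ := by linarith
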